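/- arXiv:1503.04543 — 3 statements merged into one kernel-verified Lean document; each statement's English description precedes it below -/
import Mathlib

section
/- Let n ≥ 2 be an even integer, and let K/k be a finite Galois field extension with Galois group Gal(K/k) isomorphic to D_n via generators σ, τ. Let D_n act on the rational function field K(A, B_0, …, B_{n−1}, C_0, …, C_{n−1}) in 2n+1 variables over K by field automorphisms that act on K via the Galois identification and on the variables by: σ(A) = A, σ(B_i) = B_{i+1}, σ(C_i) = C_{i+1}; τ(A) = A^{-1}B_0B_1⋯B_{n−1}, τ(B_0) = B_1C_0C_1^{-1}, τ(B_1) = B_0C_{n−1}C_0^{-1}, τ(B_i) = B_{n−i+1}C_{n−i}C_{n−i+1}^{-1} for 2 ≤ i ≤ n−1, τ(C_0) = C_0, τ(C_i) = C_{n−i} for 1 ≤ i ≤ n−1 (indices mod n). Then the fixed field L := K(A, B_0, …, C_{n−1})^{D_n} is not stably rational over k: for no r ≥ 0 is the rational function field L(y_1, …, y_r) in r variables over L isomorphic as a k-algebra to a rational function field over k. -/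
/-- The quotient `V ⧸ U` is a permutation module for the operators `s` and `t`: there is a
surjection `v` from `V` onto a free abelian group `X →₀ ℤ`, with kernel `U`, for which `s` and `t`
act by permuting coordinates. -/
def PermQuot {V : Type} [AddCommGroup V] (s t : V →+ V) (U : AddSubgroup V) : Prop :=
  ∃ (X : Type) (v : V →+ (X →₀ ℤ)) (f g : X → X), Function.Surjective v ∧
    (∀ x, v x = 0 ↔ x ∈ U) ∧ (∀ x p, v (s x) p = v x (f p)) ∧ (∀ x p, v (t x) p = v x (g p))

section Permutation

variable {V : Type} [AddCommGroup V] {s t : V →+ V} {U : AddSubgroup V}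

private theorem eq_of_forall_coord {X : Type} {v : V →+ (X →₀ ℤ)} (hv : Function.Surjective v)
    {p q : X} (h : ∀ x, v x p = v x q) : p = q := by
  obtain ⟨x, hx⟩ := hv (Finsupp.single q 1)
  have := h x
  rw [hx, Finsupp.single_eq_same] at this
  by_contra hne
  rw [Finsupp.single_eq_of_ne hne] at this
  exact zero_ne_one this

/-- In a permutation module for the Klein four-group, every class in `H²` that vanishes on all
cyclic subgroups vanishes. -/
theorem PermQuot.exists_of_antiinvariant (hP : PermQuot s t U) (hs : ∀ x, s (s x) = x)
    (ht : ∀ x, t (t x) = x) (hst : ∀ x, s (t x) = t (s x)) {γ z : V} (hsγ : γ + s γ ∈ U)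
    (htγ : γ + t γ ∈ U) (hz : γ - (z + s (t z)) ∈ U) :
    ∃ x, x + s x ∈ U ∧ γ - (t x - x) ∈ U := by
  obtain ⟨X, v, f, g, hv, hU, hf, hg⟩ := hP
  have hff : ∀ p, f (f p) = p := fun p => eq_of_forall_coord hv fun x => by
    rw [← hf, ← hf, hs]
  have hgg : ∀ p, g (g p) = p := fun p => eq_of_forall_coord hv fun x => by
    rw [← hg, ← hg, ht]
  have hfg : ∀ p, f (g p) = g (f p) := fun p => eq_of_forall_coord hv fun x => by
    rw [← hf, ← hg, ← hg, ← hf, hst]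
  have h1 : ∀ p, v γ (f p) = - v γ p := fun p => by
    have := DFunLike.congr_fun ((hU _).2 hsγ) p
    simp only [map_add, Finsupp.add_apply, hf, Finsupp.coe_zero, Pi.zero_apply] at this
    linarith
  have h2 : ∀ p, v γ (g p) = - v γ p := fun p => by
    have := DFunLike.congr_fun ((hU _).2 htγ) p
    simp only [map_add, Finsupp.add_apply, hg, Finsupp.coe_zero, Pi.zero_apply] at this
    linarith
  have h3 : ∀ p, v γ p = v z p + v z (f (g p)) := fun p => by
    have := DFunLike.congr_fun ((hU _).2 hz) p
    simp only [map_add, map_sub, Finsupp.add_apply, Finsupp.sub_apply, hg, hf, Finsupp.coe_zero,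
      Pi.zero_apply, ← hfg] at this
    linarith
  let _ : LinearOrder X := IsWellOrder.linearOrder WellOrderingRel
  set m : X → X := fun p => min p (f p) with hm
  have hmf : ∀ p, m (f p) = m p := fun p => by simp only [hm, hff, min_comm]
  have heven : ∀ p, m p = m (g p) → ∃ d, v γ p = 2 * d := by
    intro p hp
    have : g p = p ∨ g p = f p := by
      simp only [hm] at hp
      rcases min_choice p (f p) with h | h <;> rcases min_choice (g p) (f (g p)) with h' | h' <;>
        rw [h, h'] at hp
      · exact Or.inl hp.symm
      · right; have := congrArg f hp; rw [hff] at this; exact this.symm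
      · exact Or.inr hp.symm
      · left; have := congrArg f hp; rw [hff, hff] at this; exact this.symm
    rcases this with h | h
    · refine ⟨0, ?_⟩
      have := h2 p
      rw [h] at this
      linarith
    · refine ⟨v z p, ?_⟩
      rw [h3 p, h, hff]; ring
  obtain ⟨x, hx⟩ := hv (Finsupp.onFinset (v γ).support
    (fun p => if m p < m (g p) then - v γ p else if m (g p) < m p then 0 else -(v γ p) / 2)
    (fun p hp => by
      rw [Finsupp.mem_support_iff]
      contrapose! hp
      simp [hp]))
  have hx' : ∀ p, v x p = if m p < m (g p) then - v γ p else
      if m (g p) < m p then 0 else -(v γ p) / 2 := fun p => by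
    rw [hx]; rfl
  refine ⟨x, (hU _).1 ?_, (hU _).1 ?_⟩
  · ext p
    simp only [map_add, Finsupp.add_apply, hf, Finsupp.coe_zero, Pi.zero_apply, hx', hmf, ← hfg, h1]
    rcases lt_trichotomy (m p) (m (g p)) with h | h | h
    · simp [h]
    · obtain ⟨d, hd⟩ := heven p h
      simp only [h, lt_irrefl, if_false, hd]
      omega
    · simp [h, h.not_gt]
  · ext p
    simp only [map_sub, Finsupp.sub_apply, hg, Finsupp.coe_zero, Pi.zero_apply, hx', hgg, h2]
    rcases lt_trichotomy (m p) (m (g p)) with h | h | h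
    · simp [h, h.not_gt]
    · obtain ⟨d, hd⟩ := heven p h
      simp only [h, lt_irrefl, if_false, hd]
      omega
    · simp [h, h.not_gt]

/-- The first cohomology of the Klein four-group with values in a permutation module vanishes. -/
theorem PermQuot.exists_of_cocycle (hP : PermQuot s t U) (hs : ∀ x, s (s x) = x)
    (ht : ∀ x, t (t x) = x) (hst : ∀ x, s (t x) = t (s x)) {x y : V} (hx : x + s x ∈ U)
    (hy : y + t y ∈ U) (hxy : (t x - x) - (s y - y) ∈ U) :
    ∃ w, x - (s w - w) ∈ U ∧ y - (t w - w) ∈ U := by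
  obtain ⟨X, v, f, g, hv, hU, hf, hg⟩ := hP
  have hff : ∀ p, f (f p) = p := fun p => eq_of_forall_coord hv fun x => by
    rw [← hf, ← hf, hs]
  have hgg : ∀ p, g (g p) = p := fun p => eq_of_forall_coord hv fun x => by
    rw [← hg, ← hg, ht]
  have hfg : ∀ p, f (g p) = g (f p) := fun p => eq_of_forall_coord hv fun x => by
    rw [← hf, ← hg, ← hg, ← hf, hst]
  have h1 : ∀ p, v x (f p) = - v x p := fun p => by
    have := DFunLike.congr_fun ((hU _).2 hx) p
    simp only [map_add, Finsupp.add_apply, hf, Finsupp.coe_zero, Pi.zero_apply] at this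
    linarith
  have h2 : ∀ p, v y (g p) = - v y p := fun p => by
    have := DFunLike.congr_fun ((hU _).2 hy) p
    simp only [map_add, Finsupp.add_apply, hg, Finsupp.coe_zero, Pi.zero_apply] at this
    linarith
  have h3 : ∀ p, v y (f p) = v y p + v x (g p) - v x p := fun p => by
    have := DFunLike.congr_fun ((hU _).2 hxy) p
    simp only [map_sub, Finsupp.sub_apply, hg, hf, Finsupp.coe_zero, Pi.zero_apply] at this
    linarith
  let _ : LinearOrder X := IsWellOrder.linearOrder WellOrderingRel
  obtain ⟨w₁, hw₁⟩ := hv (Finsupp.onFinset (v x).support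
    (fun p => if p < f p then - v x p else 0) (fun p hp => by
      rw [Finsupp.mem_support_iff]
      contrapose! hp
      simp [hp]))
  have hw₁' : ∀ p, v w₁ p = if p < f p then - v x p else 0 := fun p => by rw [hw₁]; rfl
  have hw₁x : ∀ p, v w₁ (f p) = v w₁ p + v x p := by
    intro p
    rw [hw₁', hw₁', hff, h1]
    rcases lt_trichotomy p (f p) with h | h | h
    · simp [h, h.not_gt]
    · have h0 := h1 p
      rw [← h] at h0
      rw [← h]
      simp only [lt_irrefl, if_false]
      linarith
    · simp [h, h.not_gt]
  set y' : V := y - (t w₁ - w₁) with hy'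
  have hy'f : ∀ p, v y' (f p) = v y' p := by
    intro p
    simp only [hy', map_sub, Finsupp.sub_apply, hg, ← hfg, hw₁x, h3]
    ring
  have hy'g : ∀ p, v y' (g p) = - v y' p := by
    intro p
    simp only [hy', map_sub, Finsupp.sub_apply, hg, hgg, h2]
    ring
  set m : X → X := fun p => min p (f p) with hm
  have hmf : ∀ p, m (f p) = m p := fun p => by simp only [hm, hff, min_comm]
  have hzero : ∀ p, m p = m (g p) → v y' p = 0 := by
    intro p hp
    have hmy : ∀ q, v y' (m q) = v y' q := fun q => by
      rcases min_choice q (f q) with h | h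
      · simp only [hm, h]
      · simp only [hm, h, hy'f]
    have := hmy (g p)
    rw [← hp, hmy, hy'g] at this
    linarith
  obtain ⟨w₂, hw₂⟩ := hv (Finsupp.onFinset (v y').support
    (fun p => if m p < m (g p) then - v y' p else 0) (fun p hp => by
      rw [Finsupp.mem_support_iff]
      contrapose! hp
      simp [hp]))
  have hw₂' : ∀ p, v w₂ p = if m p < m (g p) then - v y' p else 0 := fun p => by rw [hw₂]; rfl
  refine ⟨w₁ + w₂, (hU _).1 ?_, (hU _).1 ?_⟩
  · ext p
    simp only [map_add, map_sub, Finsupp.add_apply, Finsupp.sub_apply, hf, Finsupp.coe_zero,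
      Pi.zero_apply, hw₁x, hw₂', hmf, ← hfg, hy'f]
    ring
  · have : y - (t (w₁ + w₂) - (w₁ + w₂)) = y' - (t w₂ - w₂) := by
      rw [hy', map_add]; abel
    rw [this]
    ext p
    simp only [map_sub, Finsupp.sub_apply, hg, Finsupp.coe_zero,
      Pi.zero_apply, hw₂', hgg, hy'g]
    rcases lt_trichotomy (m p) (m (g p)) with h | h | h
    · simp [h, h.not_gt]
    · simp only [h, lt_irrefl, if_false, hzero p h]
      ring
    · simp [h, h.not_gt]

/-- A class in `H²` of the Klein four-group that is trivial on cyclic subgroups stays trivial in a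
submodule all of whose relevant quotients are permutation modules. Here `V → W` is a chain in
which `U ≤ M ≤ V`, and `W ⧸ U`, `W ⧸ V`, `V ⧸ M` are permutation modules. -/
theorem exists_coboundary_of_permQuot {W : Type} [AddCommGroup W] {s' t' : W →+ W} (j : V →+ W)
    (hj : Function.Injective j) (hjs : ∀ x, j (s x) = s' (j x)) (hjt : ∀ x, j (t x) = t' (j x))
    {M : AddSubgroup V} (hUM : U ≤ M) (hP₁ : PermQuot s' t' (U.map j))
    (hP₂ : PermQuot s' t' j.range) (hP₃ : PermQuot s t M)
    (hs : ∀ x, s (s x) = x) (ht : ∀ x, t (t x) = x) (hst : ∀ x, s (t x) = t (s x))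
    (hs' : ∀ x, s' (s' x) = x) (ht' : ∀ x, t' (t' x) = x) (hst' : ∀ x, s' (t' x) = t' (s' x))
    {γ z : V} (hγ : γ ∈ M) (hsγ : s γ = -γ) (htγ : t γ = -γ) (hz : γ = z + s (t z)) :
    ∃ x ∈ M, ∃ y ∈ M, x + s x ∈ U ∧ y + t y ∈ U ∧ γ - ((t x - x) - (s y - y)) ∈ U := by
  obtain ⟨x, hx, hxγ⟩ := hP₁.exists_of_antiinvariant hs' ht' hst' (γ := j γ) (z := j z)
    (by rw [← hjs, hsγ, map_neg, add_neg_cancel]; exact zero_mem _)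
    (by rw [← hjt, htγ, map_neg, add_neg_cancel]; exact zero_mem _)
    (by rw [← hjt, ← hjs, ← map_add, ← hz, sub_self]; exact zero_mem _)
  obtain ⟨u, hu, hux⟩ := hx
  obtain ⟨u', hu', hux'⟩ := hxγ
  obtain ⟨w, ⟨x₁, hx₁⟩, y₁, hy₁⟩ := hP₂.exists_of_cocycle hs' ht' hst' (x := x) (y := 0)
    ⟨u, hux⟩ (by simp) ⟨γ - u', by rw [map_sub, hux', map_zero]; abel⟩
  have hx₁s : x₁ + s x₁ = u := hj <| by
    rw [map_add, hjs, hx₁, hux]; simp only [map_sub, hs']; abel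
  have hy₁t : y₁ + t y₁ = 0 := hj <| by
    rw [map_add, hjt, hy₁, map_zero]; simp only [map_sub, map_zero, ht']; abel
  have hxy₁ : γ - ((t x₁ - x₁) - (s y₁ - y₁)) = u' := hj <| by
    simp only [map_sub, hjt, hjs, hx₁, hy₁, hux', hst', map_zero]; abel
  obtain ⟨w', hx₂, hy₂⟩ := hP₃.exists_of_cocycle hs ht hst (x := x₁) (y := y₁)
    (by rw [hx₁s]; exact hUM hu) (by rw [hy₁t]; exact zero_mem _) (by
      have : (t x₁ - x₁) - (s y₁ - y₁) = γ - u' := by rw [← hxy₁]; abel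
      rw [this]; exact sub_mem hγ (hUM hu'))
  refine ⟨_, hx₂, _, hy₂, ?_, ?_, ?_⟩
  · convert (show u ∈ U from hu) using 1
    rw [← hx₁s]; simp only [map_sub, hs]; abel
  · convert zero_mem U using 1
    rw [← hy₁t]; simp only [map_sub, ht]; abel
  · convert (show u' ∈ U from hu') using 1
    rw [← hxy₁]; simp only [map_sub, hst]; abel

end Permutation

section Divisors

open UniqueFactorizationMonoid

/-- The operator on the (additively written) unit group of a field induced by an automorphism. -/
def unitsOp {E : Type} [Field E] (s : E ≃+* E) : Additive Eˣ →+ Additive Eˣ :=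
  (Units.map (s : E →* E)).toAdditive

/-- The (additively written) units of a ring, inside the unit group of an algebra over it. -/
def unitsOf (R E : Type) [CommRing R] [Field E] [Algebra R E] : AddSubgroup (Additive Eˣ) :=
  (Units.map (algebraMap R E : R →* E)).toAdditive.range

variable {R E : Type} [CommRing R] [IsDomain R] [UniqueFactorizationMonoid R] [Field E]
  [Algebra R E] [IsFractionRing R E]

theorem exists_divisor_coords [NormalizationMonoid R] :
    ∃ v : Additive Eˣ →+ ({p : R // Irreducible p ∧ normalize p = p} →₀ ℤ),
      ∀ (x : Additive Eˣ) (a b : R), a ≠ 0 → b ≠ 0 →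
        (x.toMul : E) * algebraMap R E b = algebraMap R E a →
        ∀ p, v x p = (multiplicity p.1 a : ℤ) - multiplicity p.1 b := by
  classical
  have hinj := IsFractionRing.injective R E
  have hex : ∀ x : Additive Eˣ, ∃ a b : R, a ≠ 0 ∧ b ≠ 0 ∧
      (x.toMul : E) * algebraMap R E b = algebraMap R E a := by
    intro x
    obtain ⟨a, b, hb, hab⟩ := IsFractionRing.div_surjective R (x.toMul : E)
    have hb0 : b ≠ 0 := nonZeroDivisors.ne_zero hb
    have hb' : algebraMap R E b ≠ 0 := by simpa using (map_ne_zero_iff _ hinj).2 hb0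
    have ha : algebraMap R E a ≠ 0 := by
      intro h
      rw [h, zero_div] at hab
      exact x.toMul.ne_zero hab.symm
    refine ⟨a, b, (map_ne_zero_iff _ hinj).1 ha, hb0, ?_⟩
    rw [← hab, div_mul_cancel₀ _ hb']
  have hmul : ∀ (p : {p : R // Irreducible p ∧ normalize p = p}) (a b : R), a ≠ 0 → b ≠ 0 →
      multiplicity p.1 (a * b) = multiplicity p.1 a + multiplicity p.1 b := fun p a b ha hb =>
    multiplicity_mul p.2.1.prime (FiniteMultiplicity.of_prime_left p.2.1.prime (mul_ne_zero ha hb))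
  choose n d hn hd hnd using hex
  have key : ∀ (x : Additive Eˣ) (a b : R), a ≠ 0 → b ≠ 0 →
      (x.toMul : E) * algebraMap R E b = algebraMap R E a →
      ∀ p : {p : R // Irreducible p ∧ normalize p = p},
        (multiplicity p.1 (n x) : ℤ) - multiplicity p.1 (d x) =
          multiplicity p.1 a - multiplicity p.1 b := by
    intro x a b ha hb hab p
    have h : n x * b = a * d x := hinj <| by
      rw [map_mul, map_mul, ← hnd, ← hab]; ring
    have h' := hmul p _ _ (hn x) hb
    rw [h, hmul p _ _ ha (hd x)] at h'
    omega
  have hfin : ∀ a : R, a ≠ 0 →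
      {p : {p : R // Irreducible p ∧ normalize p = p} | multiplicity p.1 a ≠ 0}.Finite := by
    intro a ha
    refine Set.Finite.subset ((normalizedFactors a).toFinset.finite_toSet.preimage
      Subtype.val_injective.injOn) fun p hp => ?_
    have : multiplicity p.1 a = Multiset.count p.1 (normalizedFactors a) := by
      refine multiplicity_eq_of_emultiplicity_eq_some ?_
      rw [emultiplicity_eq_count_normalizedFactors p.2.1 ha, p.2.2]
    rw [Set.mem_ofPred_eq, this] at hp
    exact Multiset.mem_toFinset.2 (Multiset.count_ne_zero.1 hp)
  refine ⟨AddMonoidHom.mk' (fun x => Finsupp.ofSupportFinite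
    (fun p => (multiplicity p.1 (n x) : ℤ) - multiplicity p.1 (d x))
    (((hfin _ (hn x)).union (hfin _ (hd x))).subset fun p hp => ?_)) fun x y => ?_, ?_⟩
  · rw [Function.mem_support] at hp
    contrapose! hp
    simp only [Set.mem_union, Set.mem_ofPred_eq, not_or, not_not] at hp
    simp [hp.1, hp.2]
  · ext p
    simp only [Finsupp.ofSupportFinite_coe, Finsupp.add_apply]
    rw [key (x + y) (n x * n y) (d x * d y) (mul_ne_zero (hn x) (hn y))
      (mul_ne_zero (hd x) (hd y)) ?_ p, hmul p _ _ (hn x) (hn y), hmul p _ _ (hd x) (hd y)]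
    · push_cast; ring
    · rw [map_mul, map_mul, ← hnd, ← hnd, toMul_add, Units.val_mul]; ring
  · intro x a b ha hb hab p
    exact key x a b ha hb hab p

/-- The group of principal divisors on a unique factorization domain is a permutation module. -/
theorem permQuot_unitsOf {s t : E ≃+* E} (hs : ∀ x, s (s x) = x) (ht : ∀ x, t (t x) = x)
    (hsR : ∀ r : R, ∃ r' : R, s (algebraMap R E r) = algebraMap R E r')
    (htR : ∀ r : R, ∃ r' : R, t (algebraMap R E r) = algebraMap R E r') :
    PermQuot (unitsOp s) (unitsOp t) (unitsOf R E) := by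
  classical
  let _ : NormalizationMonoid R := Classical.choice inferInstance
  have hinj := IsFractionRing.injective R E
  obtain ⟨v, hv⟩ := exists_divisor_coords (R := R) (E := E)
  have hperm : ∀ {s : E ≃+* E}, (∀ x, s (s x) = x) →
      (∀ r : R, ∃ r' : R, s (algebraMap R E r) = algebraMap R E r') →
      ∃ f : {p : R // Irreducible p ∧ normalize p = p} → {p : R // Irreducible p ∧ normalize p = p},
        ∀ x p, v (unitsOp s x) p = v x (f p) := by
    intro s hs hsR
    choose σ hσ using hsR
    have hσσ : ∀ r, σ (σ r) = r := fun r => hinj <| by rw [← hσ, ← hσ, hs]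
    let e : R ≃* R := ⟨⟨σ, σ, hσσ, hσσ⟩, fun a b => hinj <| by
      change algebraMap R E (σ (a * b)) = algebraMap R E (σ a * σ b)
      rw [← hσ, map_mul, map_mul, map_mul, hσ, hσ]⟩
    have he0 : ∀ a, a ≠ 0 → e a ≠ 0 := fun a ha h => ha <| hinj <| s.injective <| by
      rw [hσ, map_zero, map_zero]
      change algebraMap R E (e a) = 0
      rw [h, map_zero]
    refine ⟨fun p => ⟨normalize (e p.1), ?_, normalize_idem _⟩, fun x p => ?_⟩
    · exact (normalize_associated _).symm.irreducible ((MulEquiv.irreducible_iff e).2 p.2.1)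
    · obtain ⟨a, b, hb, hab⟩ := IsFractionRing.div_surjective R (x.toMul : E)
      have hb0 : b ≠ 0 := nonZeroDivisors.ne_zero hb
      have hb' : algebraMap R E b ≠ 0 := (map_ne_zero_iff _ hinj).2 hb0
      have ha : a ≠ 0 := by
        rintro rfl
        rw [map_zero, zero_div] at hab
        exact x.toMul.ne_zero hab.symm
      have hx : (x.toMul : E) * algebraMap R E b = algebraMap R E a := by
        rw [← hab, div_mul_cancel₀ _ hb']
      have hsx : ((unitsOp s x).toMul : E) * algebraMap R E (e b) = algebraMap R E (e a) := by
        change s (x.toMul : E) * algebraMap R E (σ b) = algebraMap R E (σ a)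
        rw [← hσ, ← hσ, ← map_mul, hx]
      have he : ∀ c, multiplicity p.1 (e c) = multiplicity (normalize (e p.1)) c := by
        intro c
        rw [multiplicity_eq_of_associated_left (normalize_associated (e p.1)).symm,
          ← multiplicity_map_eq e (a := e p.1) (b := c), show e (e p.1) = p.1 from hσσ p.1]
      rw [hv _ _ _ (he0 a ha) (he0 b hb0) hsx, hv _ _ _ ha hb0 hx, he, he]
  obtain ⟨f, hf⟩ := hperm hs hsR
  obtain ⟨g, hg⟩ := hperm ht htR
  refine ⟨_, v, f, g, ?_, fun x => ⟨fun h => ?_, ?_⟩, hf, hg⟩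
  · rw [← AddMonoidHom.range_eq_top, eq_top_iff]
    rintro c -
    induction c using Finsupp.induction_linear with
    | zero => exact zero_mem _
    | add c c' hc hc' => exact add_mem hc hc'
    | single p m =>
      have : Finsupp.single p m = m • Finsupp.single p (1 : ℤ) := by simp
      rw [this]
      refine zsmul_mem ?_ m
      have hp0 : algebraMap R E p.1 ≠ 0 := (map_ne_zero_iff _ hinj).2 p.2.1.ne_zero
      refine ⟨Additive.ofMul (Units.mk0 _ hp0), ?_⟩
      ext q
      rw [hv _ p.1 1 p.2.1.ne_zero one_ne_zero (by simp)]
      rw [multiplicity_eq_of_emultiplicity_eq_some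
          (emultiplicity_eq_count_normalizedFactors q.2.1 p.2.1.ne_zero),
        multiplicity_eq_of_emultiplicity_eq_some
          (emultiplicity_eq_count_normalizedFactors q.2.1 one_ne_zero),
        normalizedFactors_irreducible p.2.1, p.2.2, q.2.2, normalizedFactors_one,
        Multiset.count_singleton, Finsupp.single_apply]
      by_cases hpq : p = q
      · simp [hpq]
      · have hqp : q.1 ≠ p.1 := fun h => hpq (Subtype.ext h.symm)
        simp [hpq, hqp]
  · obtain ⟨a, b, hb, hab⟩ := IsFractionRing.div_surjective R (x.toMul : E)
    have hb0 : b ≠ 0 := nonZeroDivisors.ne_zero hb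
    have hb' : algebraMap R E b ≠ 0 := (map_ne_zero_iff _ hinj).2 hb0
    have ha : a ≠ 0 := by
      rintro rfl
      rw [map_zero, zero_div] at hab
      exact x.toMul.ne_zero hab.symm
    have hx : (x.toMul : E) * algebraMap R E b = algebraMap R E a := by
      rw [← hab, div_mul_cancel₀ _ hb']
    have hassoc : Associated b a := by
      rw [associated_iff_normalizedFactors_eq_normalizedFactors hb0 ha]
      ext p
      by_cases hp : Irreducible p ∧ normalize p = p
      · have := DFunLike.congr_fun h ⟨p, hp⟩
        rw [hv x a b ha hb0 hx, multiplicity_eq_of_emultiplicity_eq_some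
            (emultiplicity_eq_count_normalizedFactors hp.1 ha),
          multiplicity_eq_of_emultiplicity_eq_some
            (emultiplicity_eq_count_normalizedFactors hp.1 hb0), hp.2, Finsupp.zero_apply] at this
        omega
      · rw [Multiset.count_eq_zero_of_notMem, Multiset.count_eq_zero_of_notMem] <;>
        exact fun h => hp ⟨irreducible_of_normalized_factor _ h, normalize_normalized_factor _ h⟩
    obtain ⟨u, hu⟩ := hassoc
    refine ⟨Additive.ofMul u, Additive.toMul.injective <| Units.ext ?_⟩
    change algebraMap R E u = x.toMul
    refine mul_right_cancel₀ hb' ?_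
    rw [hx, ← hu, map_mul, mul_comm]
  · rintro ⟨u, rfl⟩
    ext p
    rw [hv _ (u.toMul : R) 1 u.toMul.ne_zero one_ne_zero (by simp), Finsupp.zero_apply,
      sub_eq_zero, multiplicity_eq_of_emultiplicity_eq_some
          (emultiplicity_eq_count_normalizedFactors p.2.1 u.toMul.ne_zero),
        multiplicity_eq_of_emultiplicity_eq_some
          (emultiplicity_eq_count_normalizedFactors p.2.1 one_ne_zero),
        (associated_iff_normalizedFactors_eq_normalizedFactors u.toMul.ne_zero one_ne_zero).1
          (associated_one_iff_isUnit.2 u.toMul.isUnit)]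

end Divisors

section Monomials

open MvPolynomial

variable {ι K E : Type} [Field K] [Field E] [Algebra K E]

theorem toMul_mem_unitsOf {u : Additive Eˣ} :
    u ∈ unitsOf K E ↔ ∃ κ : K, (u.toMul : E) = algebraMap K E κ := by
  constructor
  · rintro ⟨κ, rfl⟩
    exact ⟨(κ.toMul : K), rfl⟩
  · rintro ⟨κ, hκ⟩
    have hκ0 : κ ≠ 0 := by
      rintro rfl
      exact u.toMul.ne_zero (hκ.trans (map_zero _))
    exact ⟨Additive.ofMul (Units.mk0 κ hκ0), Additive.toMul.injective (Units.ext hκ.symm)⟩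

/-- A field generated by algebraically independent elements is the fraction field of the
polynomial ring. -/
theorem isFractionRing_of_adjoin_eq_top [Algebra (MvPolynomial ι K) E] {v : ι → E}
    (hA : ∀ p : MvPolynomial ι K, algebraMap _ E p = aeval v p) (hv : AlgebraicIndependent K v)
    (htop : IntermediateField.adjoin K (Set.range v) = ⊤) :
    IsFractionRing (MvPolynomial ι K) E := by
  have : FaithfulSMul (MvPolynomial ι K) E := (faithfulSMul_iff_algebraMap_injective _ _).2
    fun p q h => hv (by rwa [hA, hA] at h)
  refine IsFractionRing.of_field _ _ fun z => ?_
  obtain ⟨p, q, h⟩ := (IntermediateField.mem_adjoin_range_iff K v z).1 (htop ▸ trivial)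
  exact ⟨p, q, by rw [h, hA, hA]⟩

theorem unitsOf_mvPolynomial [Algebra (MvPolynomial ι K) E] {v : ι → E}
    (hA : ∀ p : MvPolynomial ι K, algebraMap _ E p = aeval v p) :
    unitsOf (MvPolynomial ι K) E = unitsOf K E := by
  ext u
  rw [toMul_mem_unitsOf]
  constructor
  · rintro ⟨p, rfl⟩
    obtain ⟨κ, -, hκ⟩ := isUnit_iff_eq_C_of_isReduced.1 p.toMul.isUnit
    refine ⟨κ, ?_⟩
    change algebraMap _ E (p.toMul : MvPolynomial ι K) = _
    rw [hκ, hA, algHom_C]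
  · rintro ⟨κ, hκ⟩
    have hκ0 : κ ≠ 0 := by
      rintro rfl
      exact u.toMul.ne_zero (hκ.trans (map_zero _))
    refine ⟨Additive.ofMul (Units.map (C : K →+* MvPolynomial ι K) (Units.mk0 κ hκ0)),
      Additive.toMul.injective (Units.ext ?_)⟩
    change algebraMap _ E (C κ) = _
    rw [hA, algHom_C, hκ]

theorem exists_aeval_of_map {s : E ≃+* E} {v : ι → E} (R : Subring E)
    (hsK : ∀ x : K, s (algebraMap K E x) ∈ R) (hsv : ∀ i, s (v i) ∈ R) (p : MvPolynomial ι K) :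
    s (aeval v p) ∈ R := by
  induction p using MvPolynomial.induction_on with
  | C a => rw [algHom_C]; exact hsK a
  | add p q hp hq => rw [map_add, map_add]; exact add_mem hp hq
  | mul_X p i hp => rw [map_mul, map_mul, aeval_X]; exact mul_mem hp (hsv i)

/-- If a field is purely transcendental over `K`, with transcendence basis fixed by `s` and `t`,
then its unit group modulo constants is a permutation module. -/
theorem permQuot_unitsOf_of_fixed {s t : E ≃+* E} (hs : ∀ x, s (s x) = x) (ht : ∀ x, t (t x) = x)
    (hsK : ∀ x : K, ∃ x' : K, s (algebraMap K E x) = algebraMap K E x')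
    (htK : ∀ x : K, ∃ x' : K, t (algebraMap K E x) = algebraMap K E x') {v : ι → E}
    (hv : AlgebraicIndependent K v) (htop : IntermediateField.adjoin K (Set.range v) = ⊤)
    (hsv : ∀ i, s (v i) = v i) (htv : ∀ i, t (v i) = v i) :
    PermQuot (unitsOp s) (unitsOp t) (unitsOf K E) := by
  let _ : Algebra (MvPolynomial ι K) E := (aeval v).toRingHom.toAlgebra
  have hA : ∀ p : MvPolynomial ι K, algebraMap _ E p = aeval v p := fun _ => rfl
  have := isFractionRing_of_adjoin_eq_top hA hv htop
  rw [← unitsOf_mvPolynomial hA]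
  have key : ∀ s : E ≃+* E, (∀ x : K, ∃ x' : K, s (algebraMap K E x) = algebraMap K E x') →
      (∀ i, s (v i) = v i) → ∀ r : MvPolynomial ι K, ∃ r' : MvPolynomial ι K,
        s (algebraMap _ E r) = algebraMap _ E r' := by
    intro s hsK hsv r
    obtain ⟨r', hr'⟩ := exists_aeval_of_map (s := s) (v := v) (aeval (R := K) v).range.toSubring
      (fun x => by obtain ⟨x', hx'⟩ := hsK x; exact ⟨C x', by rw [hx']; exact algHom_C _ _⟩)
      (fun i => ⟨X i, by rw [hsv]; exact aeval_X _ _⟩) r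
    exact ⟨r', hr'.symm⟩
  exact permQuot_unitsOf hs ht (key s hsK hsv) (key t htK htv)

variable [Fintype ι]

/-- The Laurent monomial with the given exponents, in an additively written group. -/
def laurentMonomial {V : Type} [AddCommGroup V] (b : ι → V) : (ι → ℤ) →+ V :=
  (Fintype.linearCombination ℤ b).toAddMonoidHom

theorem laurentMonomial_apply {V : Type} [AddCommGroup V] (b : ι → V) (e : ι → ℤ) :
    laurentMonomial b e = ∑ i, e i • b i := rfl

theorem laurentMonomial_single [DecidableEq ι] {V : Type} [AddCommGroup V] (b : ι → V) (i : ι) :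
    laurentMonomial b (Pi.single i 1) = b i := by
  simp [laurentMonomial_apply, Pi.single_apply]

theorem toMul_laurentMonomial_natCast (b : ι → Additive Eˣ) (d : ι →₀ ℕ) :
    ((laurentMonomial b (fun i => (d i : ℤ))).toMul : E) =
      aeval (fun i => ((b i).toMul : E)) (monomial d (1 : K)) := by
  rw [aeval_monomial, map_one, one_mul, laurentMonomial_apply, toMul_sum, Units.coe_prod,
    Finsupp.prod_fintype _ _ fun i => pow_zero _]
  simp

theorem exists_sub_natCast (e : ι → ℤ) :
    ∃ d d' : ι →₀ ℕ, e = (fun i => (d i : ℤ)) - fun i => (d' i : ℤ) := by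
  refine ⟨Finsupp.equivFunOnFinite.symm fun i => (e i).toNat,
    Finsupp.equivFunOnFinite.symm fun i => (-e i).toNat, funext fun i => ?_⟩
  simp only [Pi.sub_apply, Finsupp.equivFunOnFinite_symm_apply_apply]
  omega

theorem AlgebraicIndependent.laurentMonomial_mem_unitsOf {b : ι → Additive Eˣ}
    (hb : AlgebraicIndependent K fun i => ((b i).toMul : E)) {e : ι → ℤ}
    (he : laurentMonomial b e ∈ unitsOf K E) : e = 0 := by
  obtain ⟨d, d', rfl⟩ := exists_sub_natCast e
  obtain ⟨κ, hκ⟩ := toMul_mem_unitsOf.1 he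
  rw [map_sub, toMul_sub, Units.val_div_eq_div_val, div_eq_iff (Units.ne_zero _),
    toMul_laurentMonomial_natCast (K := K), toMul_laurentMonomial_natCast (K := K),
    ← algHom_C (aeval _), ← map_mul, C_mul_monomial, mul_one] at hκ
  have := hb hκ
  rw [monomial_eq_monomial_iff] at this
  rcases this with h | h
  · rw [h.1, sub_self]
  · exact absurd h.1 one_ne_zero

/-- If `s` and `t` act on a rational function field through Laurent monomials, then its unit group
modulo units of the Laurent polynomial ring is a permutation module. -/
theorem permQuot_laurent {s t : E ≃+* E} (hs : ∀ x, s (s x) = x) (ht : ∀ x, t (t x) = x)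
    (hsK : ∀ x : K, ∃ x' : K, s (algebraMap K E x) = algebraMap K E x')
    (htK : ∀ x : K, ∃ x' : K, t (algebraMap K E x) = algebraMap K E x') {b : ι → Additive Eˣ}
    (hb : AlgebraicIndependent K fun i => ((b i).toMul : E))
    (htop : IntermediateField.adjoin K (Set.range fun i => ((b i).toMul : E)) = ⊤)
    (hsb : ∀ i, unitsOp s (b i) ∈ (laurentMonomial b).range)
    (htb : ∀ i, unitsOp t (b i) ∈ (laurentMonomial b).range) :
    PermQuot (unitsOp s) (unitsOp t) (unitsOf K E ⊔ (laurentMonomial b).range) := by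
  classical
  set v : ι → E := fun i => ((b i).toMul : E) with hv
  let _ : Algebra (MvPolynomial ι K) E := (aeval v).toRingHom.toAlgebra
  have hA : ∀ p : MvPolynomial ι K, algebraMap _ E p = aeval v p := fun _ => rfl
  have := isFractionRing_of_adjoin_eq_top hA hb htop
  let S : Submonoid (MvPolynomial ι K) := MonoidHom.mrange (monomialOneHom K ι)
  have hSmem : ∀ {p}, p ∈ S ↔ ∃ d : ι →₀ ℕ, p = monomial d 1 :=
    ⟨fun ⟨d, hd⟩ => ⟨d.toAdd, hd.symm⟩, fun ⟨d, hd⟩ => ⟨Multiplicative.ofAdd d, hd.symm⟩⟩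
  have hS : S ≤ nonZeroDivisors (MvPolynomial ι K) := fun p hp => by
    obtain ⟨d, rfl⟩ := hSmem.1 hp
    exact mem_nonZeroDivisors_of_ne_zero (by simp)
  let R := Localization.subalgebra.ofField E S hS
  have hmon : ∀ d : ι →₀ ℕ, ((laurentMonomial b (fun i => (d i : ℤ))).toMul : E) =
      algebraMap (MvPolynomial ι K) E (monomial d 1) := fun d =>
    toMul_laurentMonomial_natCast (K := K) b d
  have hRmem : ∀ {x : E}, x ∈ R ↔ ∃ (p : MvPolynomial ι K) (e : ι → ℤ),
      x = algebraMap _ E p * ((laurentMonomial b e).toMul : E) := by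
    intro x
    constructor
    · rintro ⟨p, q, hq, rfl⟩
      obtain ⟨d, rfl⟩ := hSmem.1 hq
      refine ⟨p, -fun i => (d i : ℤ), ?_⟩
      rw [map_neg, toMul_neg, Units.val_inv_eq_inv_val, hmon]
    · rintro ⟨p, e, rfl⟩
      obtain ⟨d, d', rfl⟩ := exists_sub_natCast e
      refine ⟨p * monomial d 1, monomial d' 1, hSmem.2 ⟨d', rfl⟩, ?_⟩
      rw [map_sub, toMul_sub, Units.val_div_eq_div_val, hmon, hmon, map_mul, div_eq_mul_inv,
        mul_assoc]
  have hmonR : ∀ e, ((laurentMonomial b e).toMul : E) ∈ R := fun e =>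
    hRmem.2 ⟨1, e, by rw [map_one, one_mul]⟩
  have hKR : ∀ x : K, algebraMap K E x ∈ R := fun x => hRmem.2 ⟨C x, 0, by
    rw [hA, algHom_C, map_zero]; simp⟩
  have hdom : IsDomain R := inferInstance
  have hufd : UniqueFactorizationMonoid R := UniqueFactorizationMonoid.of_isLocalization S R
  have hunits : unitsOf R E = unitsOf K E ⊔ (laurentMonomial b).range := by
    apply le_antisymm
    · rintro _ ⟨u, rfl⟩
      obtain ⟨p, q, hq, hpq⟩ := u.toMul.val.2
      obtain ⟨p', q', hq', hpq'⟩ := u.toMul.inv.2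
      obtain ⟨d, rfl⟩ := hSmem.1 hq
      obtain ⟨d', rfl⟩ := hSmem.1 hq'
      have h1 : (u.toMul.val : E) * (u.toMul.inv : E) = 1 := by
        exact congrArg (Subtype.val : R → E) u.toMul.val_inv
      have hne : ∀ d : ι →₀ ℕ, algebraMap (MvPolynomial ι K) E (monomial d 1) ≠ 0 := fun d => by
        rw [← hmon]; exact Units.ne_zero _
      rw [hpq, hpq', ← div_eq_mul_inv, ← div_eq_mul_inv, div_mul_div_comm,
        div_eq_one_iff_eq (mul_ne_zero (hne _) (hne _)), ← map_mul, ← map_mul] at h1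
      have h2 := IsFractionRing.injective (MvPolynomial ι K) E h1
      rw [monomial_mul, one_mul] at h2
      obtain ⟨m, κ, -, hκ, rfl⟩ := dvd_monomial_one_iff_exists.1 (Dvd.intro _ h2)
      have hlast : (Units.map (algebraMap R E : R →* E)).toAdditive u
          - laurentMonomial b ((fun i => (m i : ℤ)) - fun i => (d i : ℤ)) ∈ unitsOf K E := by
        refine toMul_mem_unitsOf.2 ⟨κ, ?_⟩
        rw [toMul_sub, map_sub, toMul_sub, Units.val_div_eq_div_val, Units.val_div_eq_div_val,
          hmon, hmon]
        change (u.toMul.val : E) / _ = _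
        rw [hpq, show monomial m κ = C κ * monomial m 1 by rw [C_mul_monomial, mul_one], map_mul,
          hA (C κ), algHom_C]
        have := hne m
        have := hne d
        field_simp
      rw [← sub_add_cancel ((Units.map (algebraMap R E : R →* E)).toAdditive u)]
      exact AddSubgroup.add_mem_sup hlast ⟨_, rfl⟩
    · have hlift : ∀ u : Additive Eˣ, (u.toMul : E) ∈ R → ((-u).toMul : E) ∈ R →
          u ∈ unitsOf R E := fun u hu hu' =>
        ⟨Additive.ofMul ⟨⟨_, hu⟩, ⟨_, hu'⟩, Subtype.ext (by simp), Subtype.ext (by simp)⟩,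
          Additive.toMul.injective (Units.ext rfl)⟩
      refine sup_le (fun u hu => ?_) ?_
      · obtain ⟨κ, hκ⟩ := toMul_mem_unitsOf.1 hu
        obtain ⟨κ', hκ'⟩ := toMul_mem_unitsOf.1 (neg_mem hu)
        exact hlift _ (hκ ▸ hKR _) (hκ' ▸ hKR _)
      · rintro _ ⟨e, rfl⟩
        exact hlift _ (hmonR e) (by rw [← map_neg]; exact hmonR _)
  have key : ∀ s : E ≃+* E, (∀ x : K, ∃ x' : K, s (algebraMap K E x) = algebraMap K E x') →
      (∀ i, unitsOp s (b i) ∈ (laurentMonomial b).range) → ∀ r : R, ∃ r' : R,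
        s (algebraMap _ E r) = algebraMap _ E r' := by
    intro s hsK hsb r
    obtain ⟨p, e, hr⟩ := hRmem.1 r.2
    have h1 : s (algebraMap _ E p) ∈ R := exists_aeval_of_map (s := s) (v := v) R.toSubring
      (fun x => by obtain ⟨x', hx'⟩ := hsK x; rw [hx']; exact hKR _)
      (fun i => by
        obtain ⟨e, he⟩ := hsb i
        have : s (v i) = ((laurentMonomial b e).toMul : E) := by rw [he]; rfl
        rw [this]; exact hmonR e) p
    have h2 : s ((laurentMonomial b e).toMul : E) ∈ R := by
      have : unitsOp s (laurentMonomial b e) ∈ (laurentMonomial b).range := by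
        rw [laurentMonomial_apply, map_sum]
        exact sum_mem fun i _ => by rw [map_zsmul]; exact zsmul_mem (hsb i) _
      obtain ⟨e', he'⟩ := this
      change ((unitsOp s (laurentMonomial b e)).toMul : E) ∈ R
      rw [← he']; exact hmonR e'
    refine ⟨⟨_, mul_mem h1 h2⟩, ?_⟩
    change s (r : E) = _
    rw [hr, map_mul]; rfl
  rw [← hunits]
  exact permQuot_unitsOf hs ht (key s hsK hsb) (key t htK htb)

end Monomials

section Exponents

variable {n : ℕ}

/-- The translation by `d` on the exponents of Laurent monomials in `A`, `B i`, `C i`. -/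
def exponentRotate (d : ZMod n) (e : ℤ × (ZMod n → ℤ) × (ZMod n → ℤ)) :
    ℤ × (ZMod n → ℤ) × (ZMod n → ℤ) :=
  (e.1, fun i => e.2.1 (i - d), fun i => e.2.2 (i - d))

/-- The action of the reflection of the dihedral group on the exponents of Laurent monomials in
`A`, `B i`, `C i`. -/
def exponentReflect (e : ℤ × (ZMod n → ℤ) × (ZMod n → ℤ)) :
    ℤ × (ZMod n → ℤ) × (ZMod n → ℤ) :=
  (-e.1, fun i => e.1 + e.2.1 (1 - i), fun i => e.2.1 (-i) - e.2.1 (1 - i) + e.2.2 (-i))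

theorem exists_half_indicator {h : ℕ} (hh : 0 < h) [NeZero (h + h)] :
    ∃ p : ZMod (h + h) → ℤ, (∀ j, p (j - h) = 1 - p j) ∧ (∀ j, p (1 - j) = 1 - p j) ∧
      ∀ j, p (j + 1) - p j = (if j = 0 then 1 else 0) - if j = h then 1 else 0 := by
  have hcast : ∀ m : ℕ, (m : ZMod (h + h)).val = m % (h + h) := fun m => ZMod.val_natCast _ m
  have hn : ((h + h : ℕ) : ZMod (h + h)) = 0 := ZMod.natCast_self _
  have hmod : ∀ m : ℕ, m < h + h → (m % (h + h) = m) := fun m hm => Nat.mod_eq_of_lt hm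
  have hmod' : ∀ m : ℕ, h + h ≤ m → m < 2 * (h + h) → (m % (h + h) = m - (h + h)) :=
    fun m hm hm' => by
      rw [Nat.mod_eq_sub_mod hm, Nat.mod_eq_of_lt (by omega)]
  refine ⟨fun j => if 1 ≤ j.val ∧ j.val ≤ h then 1 else 0, fun j => ?_, fun j => ?_, fun j => ?_⟩
  all_goals
    obtain ⟨m, hm, rfl⟩ : ∃ m : ℕ, m < h + h ∧ (m : ZMod (h + h)) = j :=
      ⟨j.val, j.val_lt, ZMod.natCast_zmod_val j⟩
  · have : (m : ZMod (h + h)) - h = ((m + h : ℕ) : ZMod (h + h)) := by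
      rw [sub_eq_iff_eq_add, ← Nat.cast_add, add_assoc, Nat.cast_add m, hn, add_zero]
    rw [this]
    simp only [hcast, hmod m hm]
    rcases lt_or_ge (m + h) (h + h) with h1 | h1
    · rw [hmod _ h1]; split_ifs <;> omega
    · rw [hmod' _ h1 (by omega)]; split_ifs <;> omega
  · have : 1 - (m : ZMod (h + h)) = ((h + h + 1 - m : ℕ) : ZMod (h + h)) := by
      rw [Nat.cast_sub (by omega), Nat.cast_add, hn, Nat.cast_one, zero_add]
    rw [this]
    simp only [hcast, hmod m hm]
    rcases lt_or_ge (h + h + 1 - m) (h + h) with h1 | h1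
    · rw [hmod _ h1]; split_ifs <;> omega
    · rw [hmod' _ h1 (by omega)]; split_ifs <;> omega
  · have h0 : (m : ZMod (h + h)) = 0 ↔ m = 0 := by
      rw [← ZMod.val_eq_zero, hcast, hmod m hm]
    have h2 : (m : ZMod (h + h)) = h ↔ m = h := by
      rw [← (ZMod.val_injective (h + h)).eq_iff, hcast, hcast, hmod m hm, hmod h (by omega)]
    have : (m : ZMod (h + h)) + 1 = ((m + 1 : ℕ) : ZMod (h + h)) := by push_cast; rfl
    rw [this]
    simp only [hcast, hmod m hm, h0, h2]
    rcases lt_or_ge (m + 1) (h + h) with h1 | h1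
    · rw [hmod _ h1]; split_ifs <;> omega
    · rw [hmod' _ h1 (by omega)]; split_ifs <;> omega

/-- A locally trivial but nontrivial class in the second cohomology of the Klein four-group
generated by the half turn and a reflection, with values in the lattice of exponents. -/
theorem exists_nontrivial_class {h : ℕ} (hh : 0 < h) [NeZero (h + h)] :
    ∃ γ z : ℤ × (ZMod (h + h) → ℤ) × (ZMod (h + h) → ℤ), exponentRotate h γ = -γ ∧
      exponentReflect γ = -γ ∧ γ = z + exponentRotate h (exponentReflect z) ∧
      ∀ x y, x + exponentRotate h x = 0 → y + exponentReflect y = 0 →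
        γ - ((exponentReflect x - x) - (exponentRotate h y - y)) ≠ 0 := by
  obtain ⟨p, hp1, hp2, hp3⟩ := exists_half_indicator hh
  have hH : (h : ZMod (h + h)) + h = 0 := by rw [← Nat.cast_add, ZMod.natCast_self]
  have hneg : -(h : ZMod (h + h)) = h := neg_eq_of_add_eq_zero_left hH
  have hp4 : ∀ j, p (-j) = 1 - p (j + 1) := fun j => by
    rw [← hp2]; congr 1; ring
  have e1 : ∀ j : ZMod (h + h), j - h = 0 ↔ j = h := fun j => sub_eq_zero
  have e2 : ∀ j : ZMod (h + h), j - h = h ↔ j = 0 := fun j => by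
    rw [sub_eq_iff_eq_add, hH]
  have e3 : ∀ j : ZMod (h + h), -j = h ↔ j = h := fun j => by
    rw [neg_eq_iff_eq_neg, hneg]
  refine ⟨(0, fun j => 1 - 2 * p j, fun j => (if j = h then 1 else 0) - if j = 0 then 1 else 0),
    (1, fun j => - p j, 0), ?_, ?_, ?_, ?_⟩
  · simp only [exponentRotate, hp1, e1, e2, Prod.neg_mk, Prod.mk.injEq, neg_zero, true_and]
    exact ⟨funext fun j => by simp only [Pi.neg_apply]; ring,
      funext fun j => by simp only [Pi.neg_apply]; ring⟩
  · simp only [exponentReflect, hp2, hp4, e3, neg_eq_zero, Prod.neg_mk, Prod.mk.injEq, true_and]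
    exact ⟨funext fun j => by simp only [Pi.neg_apply]; ring,
      funext fun j => by simp only [Pi.neg_apply]; linear_combination 2 * hp3 j⟩
  · simp only [exponentRotate, exponentReflect, Prod.mk_add_mk, Prod.mk.injEq]
    refine ⟨by ring, funext fun j => ?_, funext fun j => ?_⟩
    · simp only [Pi.add_apply, hp2, hp1]; ring
    · have := hp3 (j - h)
      simp only [e1, e2] at this
      simp only [Pi.add_apply, hp2, hp4, Pi.zero_apply]
      linear_combination -this
  · rintro ⟨xa, X, Y⟩ ⟨ya, y, z⟩ hx hy hγ
    simp only [exponentRotate, exponentReflect, Prod.mk_add_mk, Prod.mk_sub_mk, Prod.mk_eq_zero,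
      funext_iff, Pi.add_apply, Pi.sub_apply, Pi.zero_apply] at hx hy hγ
    obtain ⟨hxa, hX, hY⟩ := hx
    obtain ⟨-, hy, hz⟩ := hy
    obtain ⟨-, hb, hc⟩ := hγ
    have hz0 := hz 0
    have hy0 := hy 0
    simp only [neg_zero, sub_zero] at hz0 hy0
    rcases Nat.even_or_odd' h with ⟨m, hm | hm⟩
    · have hj : (m : ZMod (h + h)) + m = h := by rw [← Nat.cast_add]; congr 1; omega
      have hcast : ∀ m : ℕ, (m : ZMod (h + h)).val = m % (h + h) := fun m => ZMod.val_natCast _ m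
      have hj0 : (m : ZMod (h + h)) ≠ 0 := by
        rw [Ne, ← ZMod.val_eq_zero, hcast, Nat.mod_eq_of_lt (by omega)]; omega
      have hjh : (m : ZMod (h + h)) ≠ h := by
        rw [Ne, ← (ZMod.val_injective (h + h)).eq_iff, hcast, hcast, Nat.mod_eq_of_lt (by omega),
          Nat.mod_eq_of_lt (by omega)]
        omega
      generalize (m : ZMod (h + h)) = j at hj hj0 hjh
      have hneg' : -j = j - h := by rw [← hj]; ring
      have hone : 1 - j = j + 1 - h := by rw [← hj]; ring
      have hbj := hb j
      have hcj := hc j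
      have hzj := hz j
      have hyj := hy (j - h)
      have hyj' := hy j
      have := hX j
      have := hX (j + 1)
      have := hY j
      have h6 : 1 - (j - h) = j + 1 := by rw [← hj]; ring
      simp only [hj0, hjh, if_false, hneg', hone, h6] at hbj hcj hzj hyj hyj'
      omega
    · have hj : ((m + 1 : ℕ) : ZMod (h + h)) + (m + 1 : ℕ) = h + 1 := by
        rw [← Nat.cast_add, ← Nat.cast_succ]; congr 1; omega
      generalize ((m + 1 : ℕ) : ZMod (h + h)) = j at hj
      have hone : 1 - j = j - h := by linear_combination -hj
      have hone' : 1 - (j - h) = j := by linear_combination -hj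
      have hbj := hb j
      have hyj := hy (j - h)
      have := hX j
      simp only [hone, hone'] at hbj hyj
      omega

end Exponents

section Descent

open MvPolynomial

/-- If a finite group acts on `K` and compatibly on `L ⊇ K`, faithfully on `K`, then `L` is
generated by `K` over the fixed field of the action on `L`. -/
theorem adjoin_fixedField_eq_top {G k K L : Type} [Group G] [Finite G] [Field k] [Field K] [Field L]
    [Algebra k K] [Algebra k L] [Algebra K L] {φ : G → K → K} {ρ : G →* (L ≃ₐ[k] L)}
    (hφ : ∀ g, (∀ x, φ g x = x) → g = 1)
    (hρ : ∀ g x, ρ g (algebraMap K L x) = algebraMap K L (φ g x)) :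
    IntermediateField.adjoin (IntermediateField.fixedField ρ.range)
      (Set.range (algebraMap K L)) = ⊤ := by
  have hfin : Finite ρ.range := inferInstanceAs (Finite (Set.range ρ))
  have : IsGalois (IntermediateField.fixedField ρ.range) L := IsGalois.of_fixed_field L ρ.range
  have : FiniteDimensional (IntermediateField.fixedField ρ.range) L :=
    inferInstanceAs (FiniteDimensional (FixedPoints.subfield ρ.range L) L)
  rw [← IsGalois.fixedField_fixingSubgroup (IntermediateField.adjoin _ _),
    ← IntermediateField.fixedField_bot]
  congr 1
  refine (Subgroup.eq_bot_iff_forall _).2 fun f hf => ?_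
  obtain ⟨g, hg⟩ : ∃ g, ∀ x, f x = ρ g x := by
    obtain ⟨⟨_, g, rfl⟩, rfl⟩ := (FixedPoints.toAlgAutMulEquiv ρ.range L).surjective f
    exact ⟨g, fun x => rfl⟩
  have : g = 1 := hφ g fun x => (algebraMap K L).injective <| by
    rw [← hρ, ← hg]
    exact (IntermediateField.mem_fixingSubgroup_iff _ _).1 hf _
      (IntermediateField.subset_adjoin _ _ ⟨x, rfl⟩)
  ext x
  rw [hg, this, map_one]; rfl

variable {σ R E : Type} [Field R] [Field E]

theorem ringHom_fractionRing_mvPolynomial_ext {f g : FractionRing (MvPolynomial σ R) →+* E}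
    (hC : ∀ a, f (algebraMap _ _ (C a : MvPolynomial σ R)) =
      g (algebraMap _ _ (C a : MvPolynomial σ R)))
    (hX : ∀ i, f (algebraMap _ _ (X i : MvPolynomial σ R)) =
      g (algebraMap _ _ (X i : MvPolynomial σ R))) : f = g :=
  IsLocalization.ringHom_ext (nonZeroDivisors (MvPolynomial σ R)) (MvPolynomial.ringHom_ext hC hX)

theorem Subfield.eq_top_of_C_mem_of_X_mem {S : Subfield (FractionRing (MvPolynomial σ R))}
    (hC : ∀ a, algebraMap _ _ (C a : MvPolynomial σ R) ∈ S)
    (hX : ∀ i, algebraMap _ _ (X i : MvPolynomial σ R) ∈ S) : S = ⊤ := by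
  have hpoly : ∀ p : MvPolynomial σ R, algebraMap _ (FractionRing (MvPolynomial σ R)) p ∈ S := by
    intro p
    induction p using MvPolynomial.induction_on with
    | C a => exact hC a
    | add p q hp hq => rw [map_add]; exact add_mem hp hq
    | mul_X p i hp => rw [map_mul]; exact mul_mem hp (hX i)
  refine eq_top_iff.2 fun x _ => ?_
  obtain ⟨p, q, -, rfl⟩ := IsFractionRing.div_surjective (MvPolynomial σ R) x
  exact div_mem (hpoly p) (hpoly q)

/-- The extension of a field automorphism to a rational function field, fixing the variables. -/
noncomputable def extendFraction (σ : Type) (s : R ≃+* R) :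
    FractionRing (MvPolynomial σ R) ≃+* FractionRing (MvPolynomial σ R) :=
  IsFractionRing.ringEquivOfRingEquiv (MvPolynomial.mapEquiv σ s)

theorem extendFraction_C (s : R ≃+* R) (a : R) :
    extendFraction σ s (algebraMap _ _ (C a : MvPolynomial σ R)) = algebraMap _ _
      (C (s a) : MvPolynomial σ R) := by
  rw [extendFraction, IsFractionRing.ringEquivOfRingEquiv_algebraMap]
  simp

theorem extendFraction_X (s : R ≃+* R) (i : σ) :
    extendFraction σ s (algebraMap _ _ (X i : MvPolynomial σ R)) = algebraMap _ _
      (X i : MvPolynomial σ R) := by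
  rw [extendFraction, IsFractionRing.ringEquivOfRingEquiv_algebraMap]
  simp

theorem extendFraction_comm {s t s' t' : R ≃+* R} (h : ∀ x, s (t x) = s' (t' x))
    (x : FractionRing (MvPolynomial σ R)) :
    extendFraction σ s (extendFraction σ t x) = extendFraction σ s' (extendFraction σ t' x) := by
  refine RingHom.congr_fun (ringHom_fractionRing_mvPolynomial_ext
    (f := (extendFraction σ s).toRingHom.comp (extendFraction σ t).toRingHom)
    (g := (extendFraction σ s').toRingHom.comp (extendFraction σ t').toRingHom)
    (fun a => ?_) fun i => ?_) x
  · simp [extendFraction_C, h]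
  · simp [extendFraction_X]

theorem extendFraction_involutive {s : R ≃+* R} (h : ∀ x, s (s x) = x)
    (x : FractionRing (MvPolynomial σ R)) : extendFraction σ s (extendFraction σ s x) = x := by
  refine RingHom.congr_fun (ringHom_fractionRing_mvPolynomial_ext
    (f := (extendFraction σ s).toRingHom.comp (extendFraction σ s).toRingHom)
    (g := RingHom.id _) (fun a => ?_) fun i => ?_) x
  · simp [extendFraction_C, h]
  · simp [extendFraction_X]

/-- If `L = F K` and the rational function field `F(σ)` is `k`-isomorphic to `k(τ)`, where `K / k`
is algebraic, then `L(σ)` is purely transcendental over `K`, with a transcendence basis fixed by the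
extensions of the automorphisms of `L / F`. -/
theorem exists_fixed_transcendenceBasis {k K L σ τ : Type} [Field k] [Field K] [Field L]
    [Algebra k K] [Algebra k L] [Algebra K L] [IsScalarTower k K L] [Algebra.IsAlgebraic k K]
    {F : IntermediateField k L} (hF : IntermediateField.adjoin F (Set.range (algebraMap K L)) = ⊤)
    (ψ : FractionRing (MvPolynomial σ F) ≃ₐ[k] FractionRing (MvPolynomial τ k)) :
    ∃ v : τ → FractionRing (MvPolynomial σ L), AlgebraicIndependent K v ∧
      IntermediateField.adjoin K (Set.range v) = ⊤ ∧
      ∀ s : L ≃+* L, (∀ x ∈ F, s x = x) → ∀ i, extendFraction σ s (v i) = v i := by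
  have hinj : Function.Injective (MvPolynomial.map (σ := σ) (algebraMap F L)) :=
    MvPolynomial.map_injective _ (algebraMap F L).injective
  let θ : FractionRing (MvPolynomial σ F) →+* FractionRing (MvPolynomial σ L) :=
    IsFractionRing.map hinj
  have hθ : ∀ p, θ (algebraMap _ _ p) = algebraMap _ _ (MvPolynomial.map (algebraMap F L) p) :=
    fun p => IsLocalization.map_eq _ _
  let Θ : FractionRing (MvPolynomial τ k) →ₐ[k] FractionRing (MvPolynomial σ L) :=
    { θ.comp (ψ.symm : _ →+* _) with
      commutes' := fun c => by
        change θ (ψ.symm (algebraMap _ _ c)) = _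
        rw [AlgEquiv.commutes, IsScalarTower.algebraMap_apply k (MvPolynomial σ F), hθ,
          IsScalarTower.algebraMap_apply k (MvPolynomial σ L) (FractionRing (MvPolynomial σ L)),
          MvPolynomial.algebraMap_apply, MvPolynomial.algebraMap_apply, MvPolynomial.map_C,
          ← IsScalarTower.algebraMap_apply k F L] }
  have hΘ : ∀ x, Θ (ψ x) = θ x := fun x => congrArg θ (ψ.symm_apply_apply x)
  refine ⟨fun i => Θ (algebraMap _ _ (X i : MvPolynomial τ k)), ?_, ?_, ?_⟩
  · have h1 := (MvPolynomial.algebraicIndependent_X τ k).map'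
      (f := IsScalarTower.toAlgHom k (MvPolynomial τ k) (FractionRing (MvPolynomial τ k)))
      (IsFractionRing.injective _ _)
    exact (h1.map' (f := Θ) Θ.toRingHom.injective).extendScalars K
  · set N := IntermediateField.adjoin K 
      (Set.range fun i => Θ (algebraMap _ _ (X i : MvPolynomial τ k))) with hN
    have h1 : N.toSubfield.comap Θ.toRingHom = ⊤ := by
      refine Subfield.eq_top_of_C_mem_of_X_mem (fun a => ?_) fun i => ?_
      · change Θ (algebraMap _ _ (algebraMap k (MvPolynomial τ k) a)) ∈ N
        rw [← IsScalarTower.algebraMap_apply, Θ.commutes, IsScalarTower.algebraMap_apply k K]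
        exact N.algebraMap_mem _
      · exact IntermediateField.subset_adjoin _ _ ⟨i, rfl⟩
    have h2 : ∀ x, θ x ∈ N := fun x => by
      rw [← hΘ]
      exact (h1 ▸ trivial : ψ x ∈ N.toSubfield.comap Θ.toRingHom)
    let P : IntermediateField F L := (N.toSubfield.comap (algebraMap L _)).toIntermediateField
      fun a => by
        have := h2 (algebraMap _ _ (C a : MvPolynomial σ F))
        rwa [hθ, map_C] at this
    have h3 : P = ⊤ := by
      rw [eq_top_iff, ← hF, IntermediateField.adjoin_le_iff]
      rintro _ ⟨x, rfl⟩
      change algebraMap L _ (algebraMap K L x) ∈ N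
      rw [← IsScalarTower.algebraMap_apply]
      exact N.algebraMap_mem x
    have h4 : N.toSubfield = ⊤ := by
      refine Subfield.eq_top_of_C_mem_of_X_mem (fun a => ?_) fun i => ?_
      · exact (h3 ▸ trivial : a ∈ P)
      · have := h2 (algebraMap _ _ (X i : MvPolynomial σ F))
        rwa [hθ, map_X] at this
    exact eq_top_iff.2 fun x _ => (h4 ▸ trivial : x ∈ N.toSubfield)
  · intro s hs i
    have h : (extendFraction σ s : _ →+* _).comp θ = θ := by
      refine ringHom_fractionRing_mvPolynomial_ext (fun a => ?_) fun i => ?_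
      · change extendFraction σ s (θ _) = _
        rw [hθ, map_C, extendFraction_C]
        congr 2
        exact hs _ a.2
      · change extendFraction σ s (θ _) = _
        rw [hθ, map_X, extendFraction_X]
    exact RingHom.congr_fun h _

end Descent

section Exponents

variable {n : ℕ} {V : Type} [AddCommGroup V]

/-- The exponents of a Laurent monomial in `A`, `B i`, `C i`, as one family. -/
def exponentVector (e : ℤ × (ZMod n → ℤ) × (ZMod n → ℤ)) : Unit ⊕ ZMod n ⊕ ZMod n → ℤ :=
  Sum.elim (fun _ => e.1) (Sum.elim e.2.1 e.2.2)

theorem exponentVector_add (e e' : ℤ × (ZMod n → ℤ) × (ZMod n → ℤ)) :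
    exponentVector (e + e') = exponentVector e + exponentVector e' := by
  ext (i | i | i) <;> rfl

theorem exponentVector_neg (e : ℤ × (ZMod n → ℤ) × (ZMod n → ℤ)) :
    exponentVector (-e) = -exponentVector e := by
  ext (i | i | i) <;> rfl

theorem exponentVector_sub (e e' : ℤ × (ZMod n → ℤ) × (ZMod n → ℤ)) :
    exponentVector (e - e') = exponentVector e - exponentVector e' := by
  ext (i | i | i) <;> rfl

theorem exponentVector_surjective : Function.Surjective (exponentVector (n := n)) := fun f =>
  ⟨(f (.inl ()), fun i => f (.inr (.inl i)), fun i => f (.inr (.inr i))), by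
    ext (i | i | i) <;> rfl⟩

theorem eq_zero_of_exponentVector_eq_zero {e : ℤ × (ZMod n → ℤ) × (ZMod n → ℤ)}
    (h : exponentVector e = 0) : e = 0 :=
  Prod.ext (congrFun h (.inl ())) (Prod.ext (funext fun i => congrFun h (.inr (.inl i)))
    (funext fun i => congrFun h (.inr (.inr i))))

variable [NeZero n] {b : Unit ⊕ ZMod n ⊕ ZMod n → V}

theorem laurentMonomial_exponentVector (e : ℤ × (ZMod n → ℤ) × (ZMod n → ℤ)) :
    laurentMonomial b (exponentVector e) = e.1 • b (.inl ()) +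
      (∑ i, e.2.1 i • b (.inr (.inl i)) + ∑ i, e.2.2 i • b (.inr (.inr i))) := by
  rw [laurentMonomial_apply, Fintype.sum_sum_type, Fintype.sum_sum_type]
  simp [exponentVector]

theorem map_laurentMonomial_rotate {s : V →+ V} {d : ZMod n}
    (hA : s (b (.inl ())) = b (.inl ()))
    (hB : ∀ i, s (b (.inr (.inl i))) = b (.inr (.inl (i + d))))
    (hC : ∀ i, s (b (.inr (.inr i))) = b (.inr (.inr (i + d))))
    (e : ℤ × (ZMod n → ℤ) × (ZMod n → ℤ)) :
    s (laurentMonomial b (exponentVector e)) =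
      laurentMonomial b (exponentVector (exponentRotate d e)) := by
  simp only [laurentMonomial_exponentVector, map_add, map_sum, map_zsmul, hA, hB, hC,
    exponentRotate]
  congr 2 <;> exact Fintype.sum_equiv (Equiv.addRight d) _ _ fun i => by simp

theorem map_laurentMonomial_reflect {t : V →+ V}
    (hA : t (b (.inl ())) = -b (.inl ()) + ∑ i, b (.inr (.inl i)))
    (hB : ∀ i, t (b (.inr (.inl i))) =
      b (.inr (.inl (1 - i))) + b (.inr (.inr (-i))) - b (.inr (.inr (1 - i))))
    (hC : ∀ i, t (b (.inr (.inr i))) = b (.inr (.inr (-i))))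
    (e : ℤ × (ZMod n → ℤ) × (ZMod n → ℤ)) :
    t (laurentMonomial b (exponentVector e)) =
      laurentMonomial b (exponentVector (exponentReflect e)) := by
  have h1 : ∀ (f : ZMod n → ℤ) (c : ZMod n → V), ∑ i, f i • c (1 - i) = ∑ i, f (1 - i) • c i :=
    fun f c => Fintype.sum_equiv (Equiv.subLeft 1) _ _ fun i => by simp
  have h2 : ∀ (f : ZMod n → ℤ) (c : ZMod n → V), ∑ i, f i • c (-i) = ∑ i, f (-i) • c i :=
    fun f c => Fintype.sum_equiv (Equiv.neg _) _ _ fun i => by simp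
  simp only [laurentMonomial_exponentVector, map_add, map_sum, map_zsmul, hA, hB, hC,
    exponentReflect, smul_add, smul_sub, Finset.sum_add_distrib, Finset.sum_sub_distrib, add_smul,
    sub_smul, neg_smul, smul_neg, Finset.smul_sum, h2 _ fun i => b (.inr (.inr i)),
    h1 _ fun i => b (.inr (.inr i)), h1 _ fun i => b (.inr (.inl i))]
  abel

end Exponents

theorem unitsOp_involutive {E : Type} [Field E] {s : E ≃+* E} (h : ∀ x, s (s x) = x)
    (x : Additive Eˣ) : unitsOp s (unitsOp s x) = x :=
  Additive.toMul.injective (Units.ext (h _))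

theorem unitsOp_comm {E : Type} [Field E] {s t s' t' : E ≃+* E} (h : ∀ x, s (t x) = s' (t' x))
    (x : Additive Eˣ) : unitsOp s (unitsOp t x) = unitsOp s' (unitsOp t' x) :=
  Additive.toMul.injective (Units.ext (h _))

theorem map_unitsOf {K L E : Type} [Field K] [Field L] [Field E] [Algebra K L] [Algebra L E]
    [Algebra K E] [IsScalarTower K L E] :
    (unitsOf K L).map (Units.map (algebraMap L E : L →* E)).toAdditive = unitsOf K E := by
  rw [unitsOf, unitsOf, AddMonoidHom.map_range]
  congr 1
  ext x
  exact (IsScalarTower.algebraMap_apply K L E _).symm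

/-- If `F(σ)` is purely transcendental over `k`, where `F` is the fixed field of a group acting on
`L`, then every locally trivial class in the second cohomology of a Klein four-group with values in
Laurent monomials over `K`, modulo constants, that vanishes in `Lˣ` is trivial. -/
theorem exists_coboundary_of_rational {k K L σ τ ι : Type} [Field k] [Field K] [Field L]
    [Algebra k K] [Algebra k L] [Algebra K L] [IsScalarTower k K L] [Algebra.IsAlgebraic k K]
    [Fintype ι]
    {F : IntermediateField k L} (hF : IntermediateField.adjoin F (Set.range (algebraMap K L)) = ⊤)
    (ψ : FractionRing (MvPolynomial σ F) ≃ₐ[k] FractionRing (MvPolynomial τ k))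
    {s t : L ≃+* L} (hs : ∀ x, s (s x) = x) (ht : ∀ x, t (t x) = x)
    (hst : ∀ x, s (t x) = t (s x)) (hsF : ∀ x ∈ F, s x = x) (htF : ∀ x ∈ F, t x = x)
    (hsK : ∀ x : K, ∃ x' : K, s (algebraMap K L x) = algebraMap K L x')
    (htK : ∀ x : K, ∃ x' : K, t (algebraMap K L x) = algebraMap K L x') {b : ι → Additive Lˣ}
    (hb : AlgebraicIndependent K fun i => ((b i).toMul : L))
    (htop : IntermediateField.adjoin K (Set.range fun i => ((b i).toMul : L)) = ⊤)
    (hsb : ∀ i, unitsOp s (b i) ∈ (laurentMonomial b).range)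
    (htb : ∀ i, unitsOp t (b i) ∈ (laurentMonomial b).range)
    {γ z : Additive Lˣ} (hγ : γ ∈ (laurentMonomial b).range) (hsγ : unitsOp s γ = -γ)
    (htγ : unitsOp t γ = -γ) (hz : γ = z + unitsOp s (unitsOp t z)) :
    ∃ x ∈ unitsOf K L ⊔ (laurentMonomial b).range, ∃ y ∈ unitsOf K L ⊔ (laurentMonomial b).range,
      x + unitsOp s x ∈ unitsOf K L ∧ y + unitsOp t y ∈ unitsOf K L ∧
      γ - ((unitsOp t x - x) - (unitsOp s y - y)) ∈ unitsOf K L := by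
  set E := FractionRing (MvPolynomial σ L)
  have hextC : ∀ (s : L ≃+* L) (x : L),
      extendFraction σ s (algebraMap L E x) = algebraMap L E (s x) := extendFraction_C
  have hextK : ∀ s : L ≃+* L, (∀ x : K, ∃ x' : K, s (algebraMap K L x) = algebraMap K L x') →
      ∀ x : K, ∃ x' : K, extendFraction σ s (algebraMap K E x) = algebraMap K E x' := by
    intro s hs x
    obtain ⟨x', hx'⟩ := hs x
    exact ⟨x', by rw [IsScalarTower.algebraMap_apply K L E, hextC, hx',
      ← IsScalarTower.algebraMap_apply]⟩
  have hs' := extendFraction_involutive (σ := σ) hs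
  have ht' := extendFraction_involutive (σ := σ) ht
  obtain ⟨v, hv, hvtop, hvfix⟩ := exists_fixed_transcendenceBasis hF ψ
  refine exists_coboundary_of_permQuot (s := unitsOp s) (t := unitsOp t)
    (s' := unitsOp (extendFraction σ s)) (t' := unitsOp (extendFraction σ t))
    (Units.map (algebraMap L E : L →* E)).toAdditive ?_ ?_ ?_ le_sup_left ?_ ?_
    (permQuot_laurent hs ht hsK htK hb htop hsb htb) (unitsOp_involutive hs)
    (unitsOp_involutive ht) (unitsOp_comm hst) (unitsOp_involutive hs') (unitsOp_involutive ht')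
    (unitsOp_comm (extendFraction_comm hst)) (le_sup_right (a := unitsOf K L) hγ) hsγ htγ hz
  · exact fun x y h => Additive.toMul.injective
      (Units.map_injective (f := (algebraMap L E : L →* E)) (algebraMap L E).injective h)
  · exact fun x => Additive.toMul.injective (Units.ext (hextC s _).symm)
  · exact fun x => Additive.toMul.injective (Units.ext (hextC t _).symm)
  · rw [map_unitsOf]
    exact permQuot_unitsOf_of_fixed hs' ht' (hextK s hsK) (hextK t htK) hv hvtop
      (hvfix s hsF) (hvfix t htF)
  · have hpoly : ∀ (s : L ≃+* L) (p : MvPolynomial σ L), ∃ p' : MvPolynomial σ L,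
        extendFraction σ s (algebraMap _ E p) = algebraMap _ E p' := fun s p =>
      ⟨_, IsFractionRing.ringEquivOfRingEquiv_algebraMap _ p⟩
    have := permQuot_unitsOf (R := MvPolynomial σ L) hs' ht' (hpoly s) (hpoly t)
    rwa [unitsOf_mvPolynomial (v := fun i => algebraMap _ E (MvPolynomial.X i : MvPolynomial σ L))] at this
    intro p
    induction p using MvPolynomial.induction_on with
    | C a => rw [MvPolynomial.algHom_C]; rfl
    | add p q hp hq => rw [map_add, map_add, hp, hq]
    | mul_X p i hp => rw [map_mul, map_mul, hp, MvPolynomial.aeval_X]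

/-- A coboundary relation between Laurent monomials modulo constants yields the corresponding
relation between exponents. -/
theorem exists_exponents_of_coboundary {n : ℕ} [NeZero n] {K L : Type} [Field K] [Field L]
    [Algebra K L] {s t : L ≃+* L}
    (hsK : ∀ x : K, ∃ x' : K, s (algebraMap K L x) = algebraMap K L x')
    (htK : ∀ x : K, ∃ x' : K, t (algebraMap K L x) = algebraMap K L x')
    {b : Unit ⊕ ZMod n ⊕ ZMod n → Additive Lˣ}
    (hb : AlgebraicIndependent K fun i => ((b i).toMul : L))
    {S T : ℤ × (ZMod n → ℤ) × (ZMod n → ℤ) → ℤ × (ZMod n → ℤ) × (ZMod n → ℤ)}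
    (hS : ∀ e, unitsOp s (laurentMonomial b (exponentVector e)) =
      laurentMonomial b (exponentVector (S e)))
    (hT : ∀ e, unitsOp t (laurentMonomial b (exponentVector e)) =
      laurentMonomial b (exponentVector (T e)))
    {γ : ℤ × (ZMod n → ℤ) × (ZMod n → ℤ)} {x y : Additive Lˣ}
    (hx : x ∈ unitsOf K L ⊔ (laurentMonomial b).range)
    (hy : y ∈ unitsOf K L ⊔ (laurentMonomial b).range)
    (hsx : x + unitsOp s x ∈ unitsOf K L) (hty : y + unitsOp t y ∈ unitsOf K L)
    (hγ : laurentMonomial b (exponentVector γ) - ((unitsOp t x - x) - (unitsOp s y - y)) ∈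
      unitsOf K L) :
    ∃ e e', e + S e = 0 ∧ e' + T e' = 0 ∧ γ - ((T e - e) - (S e' - e')) = 0 := by
  have hU : ∀ s : L ≃+* L, (∀ x : K, ∃ x' : K, s (algebraMap K L x) = algebraMap K L x') →
      ∀ u ∈ unitsOf K L, unitsOp s u ∈ unitsOf K L := fun s hs u hu => by
    obtain ⟨κ, hκ⟩ := toMul_mem_unitsOf.1 hu
    obtain ⟨κ', hκ'⟩ := hs κ
    exact toMul_mem_unitsOf.2 ⟨κ', (congrArg s hκ).trans hκ'⟩
  have hUs := hU s hsK
  have hUt := hU t htK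
  have hzero : ∀ e, laurentMonomial b (exponentVector e) ∈ unitsOf K L → e = 0 := fun e he =>
    eq_zero_of_exponentVector_eq_zero (AlgebraicIndependent.laurentMonomial_mem_unitsOf hb he)
  obtain ⟨κ, hκ, _, ⟨f, rfl⟩, rfl⟩ := AddSubgroup.mem_sup.1 hx
  obtain ⟨κ', hκ', _, ⟨f', rfl⟩, rfl⟩ := AddSubgroup.mem_sup.1 hy
  obtain ⟨e, rfl⟩ := exponentVector_surjective f
  obtain ⟨e', rfl⟩ := exponentVector_surjective f'
  refine ⟨e, e', hzero _ ?_, hzero _ ?_, hzero _ ?_⟩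
  · rw [exponentVector_add, map_add, ← hS]
    convert sub_mem hsx (add_mem hκ (hUs _ hκ)) using 1
    rw [map_add]; abel
  · rw [exponentVector_add, map_add, ← hT]
    convert sub_mem hty (add_mem hκ' (hUt _ hκ')) using 1
    rw [map_add]; abel
  · simp only [exponentVector_sub, map_sub]
    rw [← hT, ← hS]
    convert add_mem hγ (sub_mem (sub_mem (hUt _ hκ) hκ) (sub_mem (hUs _ hκ') hκ')) using 1
    simp only [map_add]; abel

/-- let `n ≥ 2` be even and `K/k` a finite Galois extension with
`Gal(K/k) ≅ D_n` (via `φ`).  Let `L = K(A, B_0, …, B_{n-1}, C_0, …, C_{n-1})` be a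
rational function field in `2n+1` variables over `K`, with `D_n` acting on `L` by
`k`-algebra automorphisms `ρ` acting on `K` through the Galois identification and
on the variables by
`σ : A ↦ A, B_i ↦ B_{i+1}, C_i ↦ C_{i+1}` and
`τ : A ↦ A⁻¹B_0⋯B_{n-1}, B_i ↦ B_{1-i}C_{-i}C_{1-i}⁻¹, C_i ↦ C_{-i}`
(indices mod `n`; the multiplicative action on `K(R^{ab})`).  Then the fixed
field `L^{D_n}` is NOT stably rational over `k`: for no `r ≥ 0` is the rational
function field in `r` variables over it `k`-isomorphic to a rational function
field over `k`. -/
theorem fixedField_relationModule_not_stably_rational (n : ℕ) (hn : 2 ≤ n)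
    (heven : Even n) [NeZero n]
    (k K : Type) [Field k] [Field K] [Algebra k K]
    [FiniteDimensional k K] [IsGalois k K]
    (φ : DihedralGroup n ≃* (K ≃ₐ[k] K))
    (L : Type) [Field L] [Algebra k L] [Algebra K L] [IsScalarTower k K L]
    (A : L) (B C : ZMod n → L)
    (hind : AlgebraicIndependent K (Sum.elim (fun _ : Unit => A) (Sum.elim B C)))
    (hgen : IntermediateField.adjoin K
      (Set.range (Sum.elim (fun _ : Unit => A) (Sum.elim B C))) = ⊤)
    (ρ : DihedralGroup n →* (L ≃ₐ[k] L))
    (hρK : ∀ (g : DihedralGroup n) (x : K),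
      ρ g (algebraMap K L x) = algebraMap K L (φ g x))
    (hσA : ρ (DihedralGroup.r 1) A = A)
    (hσB : ∀ i : ZMod n, ρ (DihedralGroup.r 1) (B i) = B (i + 1))
    (hσC : ∀ i : ZMod n, ρ (DihedralGroup.r 1) (C i) = C (i + 1))
    (hτA : ρ (DihedralGroup.sr 0) A = A⁻¹ * ∏ i : ZMod n, B i)
    (hτB : ∀ i : ZMod n,
      ρ (DihedralGroup.sr 0) (B i) = B (1 - i) * C (-i) * (C (1 - i))⁻¹)
    (hτC : ∀ i : ZMod n, ρ (DihedralGroup.sr 0) (C i) = C (-i)) :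
    ¬ ∃ (r m : ℕ),
      Nonempty ((FractionRing (MvPolynomial (Fin r)
          ↥(IntermediateField.fixedField ρ.range))) ≃ₐ[k]
        FractionRing (MvPolynomial (Fin m) k)) := by
  rintro ⟨r, m, ⟨ψ⟩⟩
  obtain ⟨h, rfl⟩ := heven
  have hh : 0 < h := by omega
  have hH : (h : ZMod (h + h)) + h = 0 := by rw [← Nat.cast_add, ZMod.natCast_self]
  set w : Unit ⊕ ZMod (h + h) ⊕ ZMod (h + h) → L :=
    Sum.elim (fun _ : Unit => A) (Sum.elim B C) with hw
  let b : Unit ⊕ ZMod (h + h) ⊕ ZMod (h + h) → Additive Lˣ := fun i =>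
    Additive.ofMul (Units.mk0 (w i) (hind.ne_zero i))
  have hrA : ∀ m : ℕ, ρ (DihedralGroup.r (m : ZMod (h + h))) A = A := by
    intro m
    induction m with
    | zero => rw [Nat.cast_zero, ← DihedralGroup.one_def, map_one]; rfl
    | succ m ih =>
      rw [Nat.cast_succ, ← DihedralGroup.r_mul_r, map_mul, AlgEquiv.mul_apply, hσA, ih]
  have hrot : ∀ D : ZMod (h + h) → L, (∀ i, ρ (DihedralGroup.r 1) (D i) = D (i + 1)) →
      ∀ (m : ℕ) i, ρ (DihedralGroup.r (m : ZMod (h + h))) (D i) = D (i + m) := by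
    intro D hD m
    induction m with
    | zero =>
      intro i
      rw [Nat.cast_zero, ← DihedralGroup.one_def, map_one, add_zero]; rfl
    | succ m ih =>
      intro i
      rw [Nat.cast_succ, ← DihedralGroup.r_mul_r, map_mul, AlgEquiv.mul_apply, hD, ih]
      congr 1; ring
  let s : L ≃+* L := (ρ (DihedralGroup.r (h : ZMod (h + h)))).toRingEquiv
  let t : L ≃+* L := (ρ (DihedralGroup.sr 0)).toRingEquiv
  have hmul : ∀ (g g' : DihedralGroup (h + h)) x, ρ g (ρ g' x) = ρ (g * g') x := fun g g' x => by
    rw [map_mul]; rfl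
  have hs : ∀ x, s (s x) = x := fun x => (hmul _ _ x).trans <| by
    rw [DihedralGroup.r_mul_r, hH, ← DihedralGroup.one_def, map_one]; rfl
  have ht : ∀ x, t (t x) = x := fun x => (hmul _ _ x).trans <| by
    rw [DihedralGroup.sr_mul_self, map_one]; rfl
  have hst : ∀ x, s (t x) = t (s x) := fun x => (hmul _ _ x).trans <|
    Eq.trans (by rw [DihedralGroup.r_mul_sr, DihedralGroup.sr_mul_r, zero_sub, zero_add,
      neg_eq_of_add_eq_zero_left hH]) (hmul _ _ x).symm
  have hbsA : unitsOp s (b (.inl ())) = b (.inl ()) :=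
    Additive.toMul.injective (Units.ext (hrA h))
  have hbsB : ∀ i, unitsOp s (b (.inr (.inl i))) = b (.inr (.inl (i + h))) := fun i =>
    Additive.toMul.injective (Units.ext (hrot B hσB h i))
  have hbsC : ∀ i, unitsOp s (b (.inr (.inr i))) = b (.inr (.inr (i + h))) := fun i =>
    Additive.toMul.injective (Units.ext (hrot C hσC h i))
  have hbtA : unitsOp t (b (.inl ())) = -b (.inl ()) + ∑ i, b (.inr (.inl i)) :=
    Additive.toMul.injective <| Units.ext <| hτA.trans <| by
      rw [toMul_add, toMul_neg, toMul_sum, Units.val_mul, Units.val_inv_eq_inv_val, Units.coe_prod]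
      rfl
  have hbtB : ∀ i, unitsOp t (b (.inr (.inl i))) =
      b (.inr (.inl (1 - i))) + b (.inr (.inr (-i))) - b (.inr (.inr (1 - i))) := fun i =>
    Additive.toMul.injective <| Units.ext <| (hτB i).trans <| by
      rw [toMul_sub, toMul_add, Units.val_div_eq_div_val, Units.val_mul, div_eq_mul_inv]
      rfl
  have hbtC : ∀ i, unitsOp t (b (.inr (.inr i))) = b (.inr (.inr (-i))) := fun i =>
    Additive.toMul.injective (Units.ext (hτC i))
  have hS := map_laurentMonomial_rotate hbsA hbsB hbsC
  have hT := map_laurentMonomial_reflect hbtA hbtB hbtC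
  have hrange : ∀ (f : Additive Lˣ →+ Additive Lˣ)
      (f' : ℤ × (ZMod (h + h) → ℤ) × (ZMod (h + h) → ℤ) → _), (∀ e, f (laurentMonomial b
        (exponentVector e)) = laurentMonomial b (exponentVector (f' e))) →
      ∀ i, f (b i) ∈ (laurentMonomial b).range := by
    intro f f' hf i
    obtain ⟨e, he⟩ := exponentVector_surjective (Pi.single i 1)
    exact ⟨_, by rw [← hf, he, laurentMonomial_single]⟩
  have hfix : ∀ g, ∀ x ∈ IntermediateField.fixedField ρ.range, ρ g x = x := fun g x hx =>
    IntermediateField.mem_fixedField_iff _ _ |>.1 hx _ ⟨g, rfl⟩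
  have hF := adjoin_fixedField_eq_top (φ := fun g x => φ g x)
    (fun g hg => (map_eq_one_iff φ φ.injective).1 (AlgEquiv.ext hg)) hρK
  obtain ⟨γ, z, hsγ, htγ, hz, hno⟩ := exists_nontrivial_class hh
  obtain ⟨x, hx, y, hy, hx', hy', hγ⟩ := exists_coboundary_of_rational hF ψ hs ht hst
    (hfix _) (hfix _) (fun x => ⟨_, hρK _ x⟩) (fun x => ⟨_, hρK _ x⟩) (b := b) hind hgen
    (hrange _ _ hS) (hrange _ _ hT) (γ := laurentMonomial b (exponentVector γ))
    (z := laurentMonomial b (exponentVector z)) ⟨_, rfl⟩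
    (by rw [hS, hsγ, exponentVector_neg, map_neg]) (by rw [hT, htγ, exponentVector_neg, map_neg])
    (by rw [hT, hS, ← map_add, ← exponentVector_add, ← hz])
  obtain ⟨e, e', he, he', hee'⟩ := exists_exponents_of_coboundary (fun x => ⟨_, hρK _ x⟩)
    (fun x => ⟨_, hρK _ x⟩) (b := b) hind hS hT hx hy hx' hy' hγ
  exact hno e e' he he' hee'
end

section
/- Let n ≥ 3 be an odd integer and k any field. Let D_n act on the rational function field k(A, B_0, …, B_{n−1}, C_0, …, C_{n−1}) in 2n+1 variables by k-algebra automorphisms (acting trivially on k): σ(A) = A, σ(B_i) = B_{i+1}, σ(C_i) = C_{i+1}; τ(A) = A^{-1}B_0B_1⋯B_{n−1}, τ(B_0) = B_1C_0C_1^{-1}, τ(B_1) = B_0C_{n−1}C_0^{-1}, τ(B_i) = B_{n−i+1}C_{n−i}C_{n−i+1}^{-1} for 2 ≤ i ≤ n−1, τ(C_0) = C_0, τ(C_i) = C_{n−i} for 1 ≤ i ≤ n−1 (indices mod n). Then the fixed field k(A, B_0, …, C_{n−1})^{D_n} is isomorphic as a k-algebra to the rational function field in one variable k(D_n)(t) over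 Noether's invariant field k(D_n). -/
theorem isAlgebraic_algebraAdjoin_of_adjoin_eq_top {k L : Type*} [Field k] [Field L] [Algebra k L]
    {s : Set L} (hs : IntermediateField.adjoin k s = ⊤) :
    Algebra.IsAlgebraic (Algebra.adjoin k s) L := by
  refine ⟨fun a => ?_⟩
  have ha : a ∈ IntermediateField.adjoin k s := hs ▸ IntermediateField.mem_top
  rw [IntermediateField.mem_adjoin_iff_div] at ha
  obtain ⟨r, hr, t, ht, rfl⟩ := ha
  have h1 := isAlgebraic_algebraMap (A := L) (⟨r, hr⟩ : Algebra.adjoin k s)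
  have h2 := isAlgebraic_algebraMap (A := L) (⟨t, ht⟩ : Algebra.adjoin k s)
  rw [div_eq_mul_inv]
  exact h1.mul h2.inv

theorem AlgebraicIndependent.of_adjoin_eq_top {k L ι κ : Type} [Field k] [Field L]
    [Algebra k L] [Fintype ι] [Fintype κ] {b : ι → L} (hb : AlgebraicIndependent k b) {v : κ → L}
    (hv : IntermediateField.adjoin k (Set.range v) = ⊤)
    (hcard : Fintype.card κ ≤ Fintype.card ι) : AlgebraicIndependent k v := by
  have := isAlgebraic_algebraAdjoin_of_adjoin_eq_top hv
  refine (Algebra.IsAlgebraic.isTranscendenceBasis_of_le_trdeg_of_finite k v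
    (le_trans ?_ hb.cardinalMk_le_trdeg)).1
  simpa using hcard

theorem AlgHom.ext_of_adjoin_range_eq_top {k L M ι : Type*} [Field k] [Field L] [Field M]
    [Algebra k L] [Algebra k M] {v : ι → L}
    (hv : IntermediateField.adjoin k (Set.range v) = ⊤) {f g : L →ₐ[k] M}
    (h : ∀ i, f (v i) = g (v i)) : f = g := by
  ext y
  have hy : y ∈ IntermediateField.adjoin k (Set.range v) := hv ▸ IntermediateField.mem_top
  have hle : IntermediateField.adjoin k (Set.range v) ≤
      (AlgHom.equalizer f g).toIntermediateField (fun x hx => by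
        rw [AlgHom.mem_equalizer] at hx ⊢
        rw [map_inv₀, map_inv₀, hx]) :=
    IntermediateField.adjoin_le_iff.2 (by rintro _ ⟨i, rfl⟩; exact h i)
  exact hle hy

theorem AlgebraicIndependent.exists_algHom {k L M ι : Type*} [Field k] [Field L] [Field M]
    [Algebra k L] [Algebra k M] {v : ι → L} {u : ι → M} (hvi : AlgebraicIndependent k v)
    (hv : IntermediateField.adjoin k (Set.range v) = ⊤) (hu : AlgebraicIndependent k u) :
    ∃ f : L →ₐ[k] M, ∀ i, f (v i) = u i := by
  let e : L ≃ₐ[k] IntermediateField.adjoin k (Set.range v) :=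
    (IntermediateField.topEquiv.symm).trans (IntermediateField.equivOfEq hv.symm)
  have he : ∀ i, e (v i) = hvi.aevalEquivField (algebraMap (MvPolynomial ι k) _ (MvPolynomial.X i)) := by
    intro i
    apply Subtype.ext
    rw [hvi.aevalEquivField_algebraMap_apply_coe, MvPolynomial.aeval_X]
    rfl
  refine ⟨((IntermediateField.val _).comp hu.aevalEquivField.toAlgHom).comp
    (hvi.aevalEquivField.symm.toAlgHom.comp e.toAlgHom), fun i => ?_⟩
  have : hvi.aevalEquivField.symm (e (v i)) = algebraMap (MvPolynomial ι k) _ (MvPolynomial.X i) := by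
    rw [he, AlgEquiv.symm_apply_apply]
  change ((hu.aevalEquivField (hvi.aevalEquivField.symm (e (v i))) : _) : M) = u i
  rw [this, hu.aevalEquivField_algebraMap_apply_coe, MvPolynomial.aeval_X]

theorem DihedralGroup.generators_induction {n : ℕ} [NeZero n] {P : DihedralGroup n → Prop}
    (h1 : P 1) (hmul : ∀ g h, P g → P h → P (g * h)) (hr : P (r 1)) (hs : P (sr 0)) (g) : P g := by
  have key : ∀ i : ZMod n, P (r i) := by
    intro i
    have : ∀ m : ℕ, P (r 1 ^ m) := by
      intro m
      induction m with
      | zero => simpa using h1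
      | succ m ih => rw [pow_succ]; exact hmul _ _ ih hr
    have h := this i.val
    rwa [r_one_pow, ZMod.natCast_zmod_val] at h
  cases g with
  | r i => exact key i
  | sr i => simpa using hmul _ _ hs (key i)

open Polynomial in
theorem nonempty_fixedField_algEquiv_fractionRing {k L M G : Type*} [Field k] [Field L] [Field M]
    [Algebra k L] [Algebra k M] [Group G] [Finite G] (ρ : G →* (M ≃ₐ[k] M))
    (ρ' : G →* (L ≃ₐ[k] L)) (f : L →ₐ[k] M) (hf : ∀ g y, f (ρ' g y) = ρ g (f y)) (q : M)
    (hq : ∀ g, ρ g q = q) (hinj : Function.Injective (eval₂RingHom (f : L →+* M) q))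
    (htop : IntermediateField.adjoin k (insert q (Set.range f)) = ⊤) :
    Nonempty (↥(IntermediateField.fixedField ρ.range) ≃ₐ[k]
      FractionRing (Polynomial ↥(IntermediateField.fixedField ρ'.range))) := by
  classical
  have := Fintype.ofFinite G
  let Φ : L[X] →ₐ[k] M :=
    { eval₂RingHom (f : L →+* M) q with
      commutes' := fun c => by
        change eval₂ (f : L →+* M) q (algebraMap k L[X] c) = _
        rw [Polynomial.algebraMap_apply, eval₂_C]
        exact f.commutes c }
  have hΦv : ∀ p, Φ p = eval₂ (f : L →+* M) q p := fun _ => rfl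
  have hΦ : Function.Injective Φ := hinj
  have hΦe : ∀ g p, ρ g (Φ p) = Φ (p.map (ρ' g : L →+* L)) := by
    intro g p
    induction p using Polynomial.induction_on' with
    | add p q hp hq => simp only [map_add, hp, hq, Polynomial.map_add]
    | monomial m a =>
      simp [hΦv, eval₂_monomial, Polynomial.map_monomial, hf, hq]
  have hΦsurj : ∀ y : M, ∃ a b : L[X], b ≠ 0 ∧ y = Φ a / Φ b := by
    intro y
    let Ψ : FractionRing L[X] →ₐ[k] M := IsFractionRing.liftAlgHom hΦ
    have hΨ : ∀ p, Ψ (algebraMap _ _ p) = Φ p := fun p => IsFractionRing.lift_algebraMap hΦ p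
    have h : IntermediateField.adjoin k (insert q (Set.range f)) ≤ Ψ.fieldRange := by
      rw [IntermediateField.adjoin_le_iff]
      rintro _ (rfl | ⟨y, rfl⟩)
      · exact ⟨algebraMap L[X] _ X, (hΨ X).trans (by simp [hΦv])⟩
      · exact ⟨algebraMap L[X] _ (C y), (hΨ (C y)).trans (by simp [hΦv])⟩
    rw [htop] at h
    obtain ⟨z, rfl⟩ := h (IntermediateField.mem_top (x := y))
    obtain ⟨a, b, hb, rfl⟩ := IsFractionRing.div_surjective (A := L[X]) z
    exact ⟨a, b, nonZeroDivisors.ne_zero hb, by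
      change Ψ _ = _
      rw [map_div₀, hΨ, hΨ]⟩
  let K := IntermediateField.fixedField ρ'.range
  let Θ₀ : K[X] →ₐ[k] M := Φ.comp (mapAlgHom K.val)
  have hΘ₀ : Function.Injective Θ₀ := hΦ.comp (Polynomial.map_injective _ K.val.injective)
  let Θ : FractionRing K[X] →ₐ[k] M := IsFractionRing.liftAlgHom hΘ₀
  have hΘ : ∀ p : K[X], Θ (algebraMap _ _ p) = Φ (p.map (K.val : K →+* L)) :=
    fun p => IsFractionRing.lift_algebraMap hΘ₀ p
  have hlift : ∀ p : L[X], (∀ g, ρ g (Φ p) = Φ p) → ∃ p' : K[X], p'.map (K.val : K →+* L) = p := by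
    intro p hp
    have : p ∈ lifts (K.val : K →+* L) := by
      rw [lifts_iff_coeff_lifts]
      intro m
      have hm : p.coeff m ∈ K := by
        rw [IntermediateField.mem_fixedField_iff]
        rintro _ ⟨g, rfl⟩
        have h := hΦ ((hΦe g p).symm.trans (hp g))
        have h' := congrArg (fun r => coeff r m) h
        simpa [coeff_map] using h'
      exact ⟨⟨_, hm⟩, rfl⟩
    exact (mem_lifts _).1 this
  have hrange : Θ.fieldRange = IntermediateField.fixedField ρ.range := by
    apply le_antisymm
    · rintro _ ⟨z, rfl⟩
      obtain ⟨a, b, hb, rfl⟩ := IsFractionRing.div_surjective (A := K[X]) z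
      rw [IntermediateField.mem_fixedField_iff]
      rintro _ ⟨g, rfl⟩
      have hfix : ∀ a : K[X], ρ g (Θ (algebraMap _ _ a)) = Θ (algebraMap _ _ a) := by
        intro a
        rw [hΘ, hΦe, Polynomial.map_map]
        congr 2
        ext c
        exact (IntermediateField.mem_fixedField_iff _ _).1 c.2 _ ⟨g, rfl⟩
      change ρ g (Θ _) = Θ _
      rw [map_div₀, map_div₀, hfix, hfix]
    · intro y hy
      rw [IntermediateField.mem_fixedField_iff] at hy
      replace hy : ∀ g, ρ g y = y := fun g => hy _ ⟨g, rfl⟩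
      obtain ⟨a, b, hb, hyab⟩ := hΦsurj y
      have hΦb : Φ b ≠ 0 := (map_ne_zero_iff Φ hΦ).2 hb
      let N : L[X] := ∏ g : G, b.map (ρ' g : L →+* L)
      let N' : L[X] := ∏ g ∈ Finset.univ.erase (1 : G), b.map (ρ' g : L →+* L)
      have hN : N = b * N' := by
        refine (Finset.mul_prod_erase Finset.univ (fun g : G => b.map (ρ' g : L →+* L))
          (Finset.mem_univ 1)).symm.trans ?_
        congr 1
        ext m
        simp [coeff_map]
      have hΦN : Φ N = ∏ g : G, ρ g (Φ b) := by
        simp only [N, map_prod, hΦe]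
      have hN0 : Φ N ≠ 0 := by
        rw [hΦN, Finset.prod_ne_zero_iff]
        intro g _
        exact (map_ne_zero_iff _ (ρ g).injective).2 hΦb
      have hNfix : ∀ g, ρ g (Φ N) = Φ N := by
        intro g
        rw [hΦN, map_prod]
        exact Fintype.prod_equiv (Equiv.mulLeft g) _ _ (fun h => by simp)
      have hy' : Φ (a * N') = y * Φ N := by
        rw [hyab, hN, map_mul, map_mul]
        field_simp
      obtain ⟨P, hP⟩ := hlift (a * N') (fun g => by rw [hy', map_mul, hy, hNfix])
      obtain ⟨Q, hQ⟩ := hlift N hNfix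
      refine ⟨algebraMap _ _ P / algebraMap _ _ Q, ?_⟩
      change Θ _ = y
      rw [map_div₀, hΘ, hΘ, hP, hQ, hy', mul_div_cancel_right₀ _ hN0]
  exact ⟨(IntermediateField.equivOfEq hrange.symm).trans (AlgEquiv.ofInjectiveField Θ).symm⟩

open Polynomial in
theorem AlgebraicIndependent.injective_eval₂RingHom {k L M ι : Type*} [Field k] [Field L] [Field M]
    [Algebra k L] [Algebra k M] {v : ι → L}
    (hv : IntermediateField.adjoin k (Set.range v) = ⊤) (f : L →ₐ[k] M) {q : M}
    (h : AlgebraicIndependent k (fun o : Option ι => o.elim q (fun i => f (v i)))) :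
    Function.Injective (eval₂RingHom (f : L →+* M) q) := by
  have h2 := (AlgebraicIndependent.option_iff.1 h).2
  set E := IntermediateField.adjoin k (Set.range fun i => f (v i)) with hE
  have h3 : Transcendental E q := by
    intro hq
    apply h2
    open scoped IntermediateField.algebraAdjoinAdjoin in
    exact (IsFractionRing.isAlgebraic_iff (Algebra.adjoin k (Set.range fun i => f (v i))) E M).2 hq
  have hfE : ∀ y, f y ∈ E := by
    intro y
    have hy : y ∈ IntermediateField.adjoin k (Set.range v) := hv ▸ IntermediateField.mem_top
    have : (IntermediateField.adjoin k (Set.range v)).map f = E := by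
      rw [IntermediateField.adjoin_map, ← Set.range_comp]; rfl
    rw [← this]
    exact ⟨y, hy, rfl⟩
  rw [transcendental_iff_injective] at h3
  let f' : L →+* E := (f : L →+* M).codRestrict E hfE
  have : (eval₂RingHom (f : L →+* M) q) = ((aeval q : E[X] →ₐ[E] M) : E[X] →+* M).comp
      (mapRingHom f') := by
    ext y
    · simp [f']; rfl
    · simp
  rw [this, RingHom.coe_comp]
  exact h3.comp (Polynomial.map_injective _ f'.injective)

open Polynomial in
theorem IntermediateField.mem_of_sum_pow_mul_mem {k L ι : Type*} [Field k] [Field L]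
    [Algebra k L] [Fintype ι] (E : IntermediateField k L) {w p : ι → L}
    (hw : Function.Injective w) (hwE : ∀ i, w i ∈ E)
    (ht : ∀ j < Fintype.card ι, ∑ i, w i ^ j * p i ∈ E) (i : ι) : p i ∈ E := by
  classical
  let w' : ι → E := fun i => ⟨w i, hwE i⟩
  have hw' : Set.InjOn w' (Finset.univ : Finset ι) :=
    fun a _ b _ h => hw (congrArg Subtype.val h)
  let l : E[X] := Lagrange.basis Finset.univ w' i
  have hdeg : l.natDegree < Fintype.card ι := by
    have := Fintype.card_pos_iff.2 ⟨i⟩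
    rw [Lagrange.natDegree_basis hw' (Finset.mem_univ i), Finset.card_univ]
    omega
  have heval : ∀ m, ((l.eval (w' m) : E) : L) = ∑ j ∈ Finset.range (Fintype.card ι),
      (l.coeff j : L) * w m ^ j := by
    intro m
    rw [eval_eq_sum_range' hdeg]
    push_cast
    rfl
  have hp : p i = ∑ j ∈ Finset.range (Fintype.card ι),
      (l.coeff j : L) * ∑ m, w m ^ j * p m := by
    calc p i = ∑ m, ((l.eval (w' m) : E) : L) * p m := by
          rw [Finset.sum_eq_single i]
          · rw [Lagrange.eval_basis_self hw' (Finset.mem_univ i)]; simp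
          · intro m _ hm
            rw [Lagrange.eval_basis_of_ne hm.symm (Finset.mem_univ m)]; simp
          · simp
      _ = _ := by
          simp_rw [heval, Finset.sum_mul, Finset.mul_sum]
          rw [Finset.sum_comm]
          simp_rw [mul_assoc]
  rw [hp]
  exact sum_mem fun j hj => mul_mem (l.coeff j).2 (ht j (Finset.mem_range.1 hj))

section CyclicCubic

variable {n : ℕ} [NeZero n] {L : Type*} [Field L]

/-- The cyclic cubic form `∑ wᵢ wᵢ₊₁²`, invariant under cyclic shifts of the `wᵢ` but not under
their reversal. -/
def cyclicCubic (w : ZMod n → L) : L := ∑ i, w i * w (i + 1) ^ 2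

/-- The reversal `∑ wᵢ wᵢ₋₁²` of `cyclicCubic w`. -/
def cyclicCubicRev (w : ZMod n → L) : L := ∑ i, w i * w (i - 1) ^ 2

theorem map_cyclicCubic_of_shift {w : ZMod n → L} (g : L →+* L) (hg : ∀ i, g (w i) = w (i + 1)) :
    g (cyclicCubic w) = cyclicCubic w := by
  simp only [cyclicCubic, map_sum, map_mul, map_pow, hg]
  exact Fintype.sum_equiv (Equiv.addRight 1) _ _ fun i => by simp

theorem map_cyclicCubicRev_of_shift {w : ZMod n → L} (g : L →+* L)
    (hg : ∀ i, g (w i) = w (i + 1)) : g (cyclicCubicRev w) = cyclicCubicRev w := by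
  simp only [cyclicCubicRev, map_sum, map_mul, map_pow, hg]
  exact Fintype.sum_equiv (Equiv.addRight 1) _ _ fun i => by simp

theorem map_cyclicCubic_of_neg {w : ZMod n → L} (g : L →+* L) (hg : ∀ i, g (w i) = w (-i)) :
    g (cyclicCubic w) = cyclicCubicRev w := by
  simp only [cyclicCubic, cyclicCubicRev, map_sum, map_mul, map_pow, hg]
  exact Fintype.sum_equiv (Equiv.neg _) _ _ fun i => by
    rw [Equiv.neg_apply, neg_add']

theorem map_cyclicCubicRev_of_neg {w : ZMod n → L} (g : L →+* L) (hg : ∀ i, g (w i) = w (-i)) :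
    g (cyclicCubicRev w) = cyclicCubic w := by
  simp only [cyclicCubic, cyclicCubicRev, map_sum, map_mul, map_pow, hg]
  exact Fintype.sum_equiv (Equiv.neg _) _ _ fun i => by
    rw [Equiv.neg_apply, neg_sub', sub_neg_eq_add]

theorem cyclicCubic_mul (w : ZMod n → L) (c : L) :
    cyclicCubic (fun i => w i * c) = cyclicCubic w * c ^ 3 := by
  simp only [cyclicCubic, Finset.sum_mul]
  exact Finset.sum_congr rfl fun i _ => by ring

theorem cyclicCubicRev_mul (w : ZMod n → L) (c : L) :
    cyclicCubicRev (fun i => w i * c) = cyclicCubicRev w * c ^ 3 := by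
  simp only [cyclicCubicRev, Finset.sum_mul]
  exact Finset.sum_congr rfl fun i _ => by ring

variable {k : Type*} [Field k] [Algebra k L]

theorem cyclicCubic_mem (E : IntermediateField k L) {w : ZMod n → L} (hw : ∀ i, w i ∈ E) :
    cyclicCubic w ∈ E :=
  sum_mem fun _ _ => mul_mem (hw _) (pow_mem (hw _) _)

theorem cyclicCubicRev_mem (E : IntermediateField k L) {w : ZMod n → L} (hw : ∀ i, w i ∈ E) :
    cyclicCubicRev w ∈ E :=
  sum_mem fun _ _ => mul_mem (hw _) (pow_mem (hw _) _)

theorem AlgebraicIndependent.cyclicCubic_ne (hn : 3 ≤ n) {w : ZMod n → L}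
    (hw : AlgebraicIndependent k w) : cyclicCubic w ≠ cyclicCubicRev w := by
  intro h
  let P : MvPolynomial (ZMod n) k :=
    ∑ i, MvPolynomial.X i * MvPolynomial.X (i + 1) ^ 2 -
      ∑ i, MvPolynomial.X i * MvPolynomial.X (i - 1) ^ 2
  have hP : MvPolynomial.aeval w P = 0 := by
    simp only [P, map_sub, map_sum, map_mul, map_pow, MvPolynomial.aeval_X]
    exact sub_eq_zero.2 h
  have hP0 : P = 0 := (injective_iff_map_eq_zero _).1 hw P hP
  have : Fact (1 < n) := ⟨by omega⟩
  have h2 : (1 : ZMod n) + 1 ≠ 0 := by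
    intro h
    have := (ZMod.natCast_eq_zero_iff 2 n).1 (by rw [← h]; norm_num)
    have := Nat.le_of_dvd (by norm_num) this
    omega
  let e : ZMod n → Polynomial k := fun i => if i = 0 then 1 else if i = 1 then Polynomial.X else 0
  have hPe : MvPolynomial.aeval e P = 0 := by rw [hP0, map_zero]
  have e0 : e 0 = 1 := by simp [e]
  have e1 : e 1 = Polynomial.X := by simp [e]
  have eo : ∀ i, i ≠ 0 → i ≠ 1 → e i = 0 := fun i h0 h1 => by simp [e, h0, h1]
  have hneg : (0 : ZMod n) - 1 ≠ 1 := fun h => h2 (by linear_combination -h)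
  have hsum1 : ∑ i, e i * e (i + 1) ^ 2 = (Polynomial.X : Polynomial k) ^ 2 := by
    rw [Finset.sum_eq_single 0]
    · simp [e0, e1]
    · intro i _ hi
      by_cases hi1 : i = 1
      · subst hi1; rw [eo (1 + 1) h2 (by simp)]; simp
      · rw [eo i hi hi1]; simp
    · simp
  have hsum2 : ∑ i, e i * e (i - 1) ^ 2 = (Polynomial.X : Polynomial k) := by
    rw [Finset.sum_eq_single 1]
    · simp [e0, e1]
    · intro i _ hi
      by_cases hi1 : i = 0
      · subst hi1; rw [eo (0 - 1) (by simp) hneg]; simp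
      · rw [eo i hi1 hi]; simp
    · simp
  simp only [P, map_sub, map_sum, map_mul, map_pow, MvPolynomial.aeval_X] at hPe
  rw [hsum1, hsum2] at hPe
  have := congrArg (fun p => Polynomial.coeff p 2) hPe
  simp [Polynomial.coeff_X] at this

end CyclicCubic

/-- Recover two elements from two independent linear combinations. -/
theorem IntermediateField.mem_and_mem_of_add_mem {k L : Type*} [Field k] [Field L] [Algebra k L]
    (E : IntermediateField k L) {c d a b : L} (hc : c ∈ E) (hd : d ∈ E) (hcd : c ≠ d)
    (h1 : a + b ∈ E) (h2 : c * a + d * b ∈ E) : a ∈ E ∧ b ∈ E := by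
  have h0 : c - d ≠ 0 := sub_ne_zero.2 hcd
  have ha : a ∈ E := by
    have : a = ((c * a + d * b) - d * (a + b)) / (c - d) := by field_simp; ring
    rw [this]
    exact div_mem (sub_mem h2 (mul_mem hd h1)) (sub_mem hc hd)
  exact ⟨ha, by simpa using sub_mem h1 ha⟩

theorem map_sum_pow_mul_of_perm {L ι : Type*} [Field L] [Fintype ι] (e : ι ≃ ι) {w p : ι → L}
    (g : L →+* L) (hw : ∀ i, g (w i) = w (e i)) (hp : ∀ i, g (p i) = p (e i)) (j : ℕ) :
    g (∑ i, w i ^ j * p i) = ∑ i, w i ^ j * p i := by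
  simp only [map_sum, map_mul, map_pow, hw, hp]
  exact Fintype.sum_equiv e _ _ fun _ => rfl

theorem nonempty_fixedField_algEquiv_of_generators {n : ℕ} [NeZero n] {ι k L M : Type*} [Field k]
    [Field L] [Field M] [Algebra k L] [Algebra k M] (ρ : DihedralGroup n →* (M ≃ₐ[k] M))
    (ρ' : DihedralGroup n →* (L ≃ₐ[k] L)) {w : ZMod n → M} {t : ι → M} {q : M}
    {w' : ZMod n → L} {t' : ι → L}
    (hσw : ∀ i, ρ (.r 1) (w i) = w (i + 1)) (hτw : ∀ i, ρ (.sr 0) (w i) = w (-i))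
    (hσt : ∀ j, ρ (.r 1) (t j) = t j) (hτt : ∀ j, ρ (.sr 0) (t j) = t j)
    (hσq : ρ (.r 1) q = q) (hτq : ρ (.sr 0) q = q)
    (hσw' : ∀ i, ρ' (.r 1) (w' i) = w' (i + 1)) (hτw' : ∀ i, ρ' (.sr 0) (w' i) = w' (-i))
    (hσt' : ∀ j, ρ' (.r 1) (t' j) = t' j) (hτt' : ∀ j, ρ' (.sr 0) (t' j) = t' j)
    (hind : AlgebraicIndependent k (fun o : Option (ZMod n ⊕ ι) => o.elim q (Sum.elim w t)))
    (hgen : IntermediateField.adjoin k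
      (Set.range fun o : Option (ZMod n ⊕ ι) => o.elim q (Sum.elim w t)) = ⊤)
    (hind' : AlgebraicIndependent k (Sum.elim w' t'))
    (hgen' : IntermediateField.adjoin k (Set.range (Sum.elim w' t')) = ⊤) :
    Nonempty (↥(IntermediateField.fixedField ρ.range) ≃ₐ[k]
      FractionRing (Polynomial ↥(IntermediateField.fixedField ρ'.range))) := by
  obtain ⟨f, hf⟩ := hind'.exists_algHom hgen' (AlgebraicIndependent.option_iff.1 hind).1
  have hfw : ∀ i, f (w' i) = w i := fun i => hf (Sum.inl i)
  have hft : ∀ j, f (t' j) = t j := fun j => hf (Sum.inr j)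
  have hequi : ∀ g, f.comp (ρ' g).toAlgHom = (ρ g).toAlgHom.comp f := by
    intro g
    induction g using DihedralGroup.generators_induction with
    | h1 => ext; simp
    | hmul g h hg hh =>
      ext y
      have h1 := DFunLike.congr_fun hg (ρ' h y)
      have h2 := DFunLike.congr_fun hh y
      simp only [AlgHom.comp_apply, AlgEquiv.coe_toAlgHom] at h1 h2
      simp [AlgEquiv.mul_apply, h1, h2]
    | hr =>
      refine AlgHom.ext_of_adjoin_range_eq_top hgen' ?_
      rintro (i | j)
      · simp [hσw', hfw, hσw]
      · simp [hσt', hft, hσt]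
    | hs =>
      refine AlgHom.ext_of_adjoin_range_eq_top hgen' ?_
      rintro (i | j)
      · simp [hτw', hfw, hτw]
      · simp [hτt', hft, hτt]
  refine nonempty_fixedField_algEquiv_fractionRing ρ ρ' f
    (fun g y => DFunLike.congr_fun (hequi g) y) q ?_ ?_ ?_
  · intro g
    induction g using DihedralGroup.generators_induction with
    | h1 => simp
    | hmul g h hg hh => rw [map_mul, AlgEquiv.mul_apply, hh, hg]
    | hr => exact hσq
    | hs => exact hτq
  · exact AlgebraicIndependent.injective_eval₂RingHom hgen' f (by simpa only [hf] using hind)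
  · rw [eq_top_iff, ← hgen]
    refine IntermediateField.adjoin.mono k _ _ ?_
    rintro _ ⟨_ | i | j, rfl⟩
    · exact Set.mem_insert _ _
    · exact Set.mem_insert_of_mem _ ⟨w' i, hfw i⟩
    · exact Set.mem_insert_of_mem _ ⟨t' j, hft j⟩

theorem exists_generators_regular {n : ℕ} [NeZero n] (hn : 3 ≤ n) {k L : Type} [Field k] [Field L]
    [Algebra k L] {x : DihedralGroup n → L} (hind : AlgebraicIndependent k x)
    (hgen : IntermediateField.adjoin k (Set.range x) = ⊤)
    (ρ : DihedralGroup n →* (L ≃ₐ[k] L)) (hρ : ∀ h g : DihedralGroup n, ρ h (x g) = x (h * g)) :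
    ∃ (w : ZMod n → L) (t : Fin n → L),
      (∀ i, ρ (.r 1) (w i) = w (i + 1)) ∧ (∀ i, ρ (.sr 0) (w i) = w (-i)) ∧
      (∀ j, ρ (.r 1) (t j) = t j) ∧ (∀ j, ρ (.sr 0) (t j) = t j) ∧
      AlgebraicIndependent k (Sum.elim w t) ∧
      IntermediateField.adjoin k (Set.range (Sum.elim w t)) = ⊤ := by
  let y : ZMod n → L := fun i => x (.r i)
  let z : ZMod n → L := fun i => x (.sr (-i))
  let w : ZMod n → L := fun i => y i + z i
  let p : ZMod n → L := fun i => cyclicCubic w * y i + cyclicCubicRev w * z i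
  let t : Fin n → L := fun j => ∑ i, w i ^ (j : ℕ) * p i
  have htop : ∀ E : IntermediateField k L, (∀ i, y i ∈ E) → (∀ i, z i ∈ E) → E = ⊤ := by
    intro E hy hz
    rw [eq_top_iff, ← hgen, IntermediateField.adjoin_le_iff]
    rintro _ ⟨i | i, rfl⟩
    · exact hy i
    · simpa [z] using hz (-i)
  have hσy : ∀ i, ρ (.r 1) (y i) = y (i + 1) := fun i => by
    simp [y, hρ, add_comm]
  have hσz : ∀ i, ρ (.r 1) (z i) = z (i + 1) := fun i => by
    simp [z, hρ, add_comm, sub_eq_add_neg]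
  have hτy : ∀ i, ρ (.sr 0) (y i) = z (-i) := fun i => by simp [y, z, hρ]
  have hτz : ∀ i, ρ (.sr 0) (z i) = y (-i) := fun i => by simp [y, z, hρ]
  have hσw : ∀ i, ρ (.r 1) (w i) = w (i + 1) := fun i => by simp only [w, map_add, hσy, hσz]
  have hτw : ∀ i, ρ (.sr 0) (w i) = w (-i) := fun i => by
    simp only [w, map_add, hτy, hτz, add_comm]
  have hσp : ∀ i, ρ (.r 1) (p i) = p (i + 1) := fun i => by
    simp only [p, map_add, map_mul, hσy, hσz]
    rw [show ρ (.r 1) (cyclicCubic w) = _ from map_cyclicCubic_of_shift (ρ (.r 1) : L →+* L) hσw,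
      show ρ (.r 1) (cyclicCubicRev w) = _ from
        map_cyclicCubicRev_of_shift (ρ (.r 1) : L →+* L) hσw]
  have hτp : ∀ i, ρ (.sr 0) (p i) = p (-i) := fun i => by
    simp only [p, map_add, map_mul, hτy, hτz]
    rw [show ρ (.sr 0) (cyclicCubic w) = _ from map_cyclicCubic_of_neg (ρ (.sr 0) : L →+* L) hτw,
      show ρ (.sr 0) (cyclicCubicRev w) = _ from
        map_cyclicCubicRev_of_neg (ρ (.sr 0) : L →+* L) hτw, add_comm]
  have hcard : Fintype.card (DihedralGroup n) = n + n := by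
    rw [← Nat.card_eq_fintype_card, DihedralGroup.nat_card, two_mul]
  have hwz : AlgebraicIndependent k (Sum.elim w z) := by
    refine hind.of_adjoin_eq_top (htop _ (fun i => ?_) fun i => ?_) (by simp [hcard, ZMod.card])
    · have h1 := IntermediateField.subset_adjoin k (Set.range (Sum.elim w z)) ⟨Sum.inl i, rfl⟩
      have h2 := IntermediateField.subset_adjoin k (Set.range (Sum.elim w z)) ⟨Sum.inr i, rfl⟩
      simpa [w] using sub_mem h1 h2
    · exact IntermediateField.subset_adjoin k _ ⟨Sum.inr i, rfl⟩
  have hw : AlgebraicIndependent k w := hwz.comp Sum.inl Sum.inl_injective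
  have hwt : IntermediateField.adjoin k (Set.range (Sum.elim w t)) = ⊤ := by
    set E := IntermediateField.adjoin k (Set.range (Sum.elim w t))
    have hwE : ∀ i, w i ∈ E := fun i => IntermediateField.subset_adjoin k _ ⟨Sum.inl i, rfl⟩
    have htE : ∀ j, t j ∈ E := fun j => IntermediateField.subset_adjoin k _ ⟨Sum.inr j, rfl⟩
    have hpE : ∀ i, p i ∈ E := E.mem_of_sum_pow_mul_mem hw.injective hwE
      fun j hj => htE ⟨j, by rwa [ZMod.card] at hj⟩
    have key := fun i => E.mem_and_mem_of_add_mem (cyclicCubic_mem E hwE)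
      (cyclicCubicRev_mem E hwE) (hw.cyclicCubic_ne hn) (hwE i) (hpE i)
    exact htop E (fun i => (key i).1) fun i => (key i).2
  exact ⟨w, t, hσw, hτw,
    fun j => map_sum_pow_mul_of_perm (Equiv.addRight 1) (ρ (.r 1) : L →+* L) hσw hσp j,
    fun j => map_sum_pow_mul_of_perm (Equiv.neg _) (ρ (.sr 0) : L →+* L) hτw hτp j,
    hind.of_adjoin_eq_top hwt (by simp [hcard, ZMod.card]), hwt⟩

theorem exists_generators_relationModule {n : ℕ} [NeZero n] (hn : 3 ≤ n) (hodd : Odd n)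
    {k L : Type} [Field k] [Field L] [Algebra k L] {A : L} {B C : ZMod n → L}
    (hind : AlgebraicIndependent k (Sum.elim (fun _ : Unit => A) (Sum.elim B C)))
    (hgen : IntermediateField.adjoin k
      (Set.range (Sum.elim (fun _ : Unit => A) (Sum.elim B C))) = ⊤)
    (ρ : DihedralGroup n →* (L ≃ₐ[k] L))
    (hσA : ρ (.r 1) A = A) (hσB : ∀ i, ρ (.r 1) (B i) = B (i + 1))
    (hσC : ∀ i, ρ (.r 1) (C i) = C (i + 1)) (hτA : ρ (.sr 0) A = A⁻¹ * ∏ i, B i)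
    (hτB : ∀ i, ρ (.sr 0) (B i) = B (1 - i) * C (-i) * (C (1 - i))⁻¹)
    (hτC : ∀ i, ρ (.sr 0) (C i) = C (-i)) :
    ∃ (w : ZMod n → L) (t : Fin n → L) (q : L),
      (∀ i, ρ (.r 1) (w i) = w (i + 1)) ∧ (∀ i, ρ (.sr 0) (w i) = w (-i)) ∧
      (∀ j, ρ (.r 1) (t j) = t j) ∧ (∀ j, ρ (.sr 0) (t j) = t j) ∧
      ρ (.r 1) q = q ∧ ρ (.sr 0) q = q ∧
      AlgebraicIndependent k (fun o : Option (ZMod n ⊕ Fin n) => o.elim q (Sum.elim w t)) ∧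
      IntermediateField.adjoin k
        (Set.range fun o : Option (ZMod n ⊕ Fin n) => o.elim q (Sum.elim w t)) = ⊤ := by
  obtain ⟨m, hm⟩ := hodd
  let h : ZMod n := m + 1
  have hh : h + h = 1 := by
    have : ((2 * m + 1 : ℕ) : ZMod n) = 0 := by rw [← hm]; exact ZMod.natCast_self n
    push_cast at this
    linear_combination this
  have hA0 : A ≠ 0 := hind.ne_zero (Sum.inl ())
  have hB0 : ∀ i, B i ≠ 0 := fun i => hind.ne_zero (Sum.inr (Sum.inl i))
  have hC0 : ∀ i, C i ≠ 0 := fun i => hind.ne_zero (Sum.inr (Sum.inr i))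
  let F : ZMod n → L := fun i => B (i + h) * C (i + h - 1) / C i
  have hF0 : ∀ i, F i ≠ 0 := fun i => div_ne_zero (mul_ne_zero (hB0 _) (hC0 _)) (hC0 _)
  have hσF : ∀ i, ρ (.r 1) (F i) = F (i + 1) := fun i => by
    simp only [F, map_div₀, map_mul, hσB, hσC]
    ring_nf
  have hτF : ∀ i, ρ (.sr 0) (F i) = F (-i) := fun i => by
    simp only [F, map_div₀, map_mul, hτB, hτC]
    rw [show 1 - (i + h) = -i + h by linear_combination -hh,
      show -(i + h) = -i + h - 1 by linear_combination -hh,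
      show -(i + h - 1) = -i + h by linear_combination -hh]
    field_simp [hC0 (-i + h)]
  have hprod : ∏ i, B i = ∏ i, F i := by
    simp only [F, Finset.prod_div_distrib, Finset.prod_mul_distrib]
    rw [Fintype.prod_equiv (Equiv.addRight h) (fun i => B (i + h)) B fun i => rfl,
      Fintype.prod_equiv (Equiv.addRight (h - 1)) (fun i => C (i + h - 1)) C fun i => by
        simp [add_sub_assoc],
      mul_div_cancel_right₀ _ (Finset.prod_ne_zero_iff.2 fun i _ => hC0 i)]
  have htop : ∀ E : IntermediateField k L, A ∈ E → (∀ i, F i ∈ E) → (∀ i, C i ∈ E) → E = ⊤ := by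
    intro E hA hF hC
    rw [eq_top_iff, ← hgen, IntermediateField.adjoin_le_iff]
    rintro _ ⟨_ | i | i, rfl⟩
    · exact hA
    · have : B i = F (i - h) * C (i - h) / C (i - 1) := by
        simp only [F, sub_add_cancel]
        field_simp [hC0]
      simp only [Sum.elim_inr, Sum.elim_inl]
      rw [this]
      exact div_mem (mul_mem (hF _) (hC _)) (hC _)
    · exact hC i
  have hAFC : AlgebraicIndependent k (Sum.elim (fun _ : Unit => A) (Sum.elim F C)) := by
    refine hind.of_adjoin_eq_top (htop _ ?_ ?_ ?_) le_rfl
    · exact IntermediateField.subset_adjoin k _ ⟨Sum.inl (), rfl⟩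
    · exact fun i => IntermediateField.subset_adjoin k _ ⟨Sum.inr (Sum.inl i), rfl⟩
    · exact fun i => IntermediateField.subset_adjoin k _ ⟨Sum.inr (Sum.inr i), rfl⟩
  have hF : AlgebraicIndependent k F :=
    hAFC.comp (Sum.inr ∘ Sum.inl) (Sum.inr_injective.comp Sum.inl_injective)
  let S : L := ∑ i, F i
  have hS0 : S ≠ 0 := by
    intro h0
    have h1 := (injective_iff_map_eq_zero _).1 hF (∑ i, MvPolynomial.X i) (by simpa using h0)
    have h2 := congrArg (MvPolynomial.aeval (Pi.single 0 1 : ZMod n → k)) h1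
    simp at h2
  have hσS : ρ (.r 1) S = S := by
    simp only [S, map_sum, hσF]
    exact Fintype.sum_equiv (Equiv.addRight 1) _ _ fun _ => rfl
  have hτS : ρ (.sr 0) S = S := by
    simp only [S, map_sum, hτF]
    exact Fintype.sum_equiv (Equiv.neg _) _ _ fun _ => rfl
  let A' : L := A⁻¹ * ∏ i, F i
  have hP0 : ∏ i, F i ≠ 0 := Finset.prod_ne_zero_iff.2 fun i _ => hF0 i
  have hτA₁ : ρ (.sr 0) A = A' := by rw [hτA, hprod]
  have hσA' : ρ (.r 1) A' = A' := by
    simp only [A', map_mul, map_inv₀, hσA, map_prod, hσF]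
    congr 1
    exact Fintype.prod_equiv (Equiv.addRight 1) _ _ fun _ => rfl
  have hτA' : ρ (.sr 0) A' = A := by
    simp only [A', map_mul, map_inv₀, hτA₁, map_prod, hτF]
    rw [Fintype.prod_equiv (Equiv.neg _) (fun i => F (-i)) F fun _ => rfl]
    field_simp
  let a : L := A / S ^ (m + 1)
  let a' : L := A' / S ^ (m + 1)
  have hσa : ρ (.r 1) a = a := by simp only [a, map_div₀, map_pow, hσA, hσS]
  have hσa' : ρ (.r 1) a' = a' := by simp only [a', map_div₀, map_pow, hσA', hσS]
  have hτa : ρ (.sr 0) a = a' := by simp only [a, a', map_div₀, map_pow, hτA₁, hτS]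
  have hτa' : ρ (.sr 0) a' = a := by simp only [a, a', map_div₀, map_pow, hτA', hτS]
  let q₀ : L := a + a'
  have hσq₀ : ρ (.r 1) q₀ = q₀ := by simp only [q₀, map_add, hσa, hσa']
  have hτq₀ : ρ (.sr 0) q₀ = q₀ := by simp only [q₀, map_add, hτa, hτa', add_comm]
  have hq₀ : q₀ ≠ 0 := by
    intro h0
    have h1 : A ^ 2 + ∏ i, F i = 0 := by
      have : A ^ 2 + ∏ i, F i = q₀ * (S ^ (m + 1) * A) := by
        simp only [q₀, a, a', A']
        field_simp
      rw [this, h0, zero_mul]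
    have h2 := (injective_iff_map_eq_zero _).1 hAFC
      (MvPolynomial.X (Sum.inl ()) ^ 2 + ∏ i, MvPolynomial.X (Sum.inr (Sum.inl i)))
      (by simpa using h1)
    have h3 := congrArg (MvPolynomial.aeval
      (Sum.elim (fun _ => 1) (fun _ => 0) : Unit ⊕ (ZMod n ⊕ ZMod n) → k)) h2
    simp [NeZero.ne n] at h3
  let c : L := q₀ / S
  have hc0 : c ≠ 0 := div_ne_zero hq₀ hS0
  let w : ZMod n → L := fun i => F i * c
  have hσw : ∀ i, ρ (.r 1) (w i) = w (i + 1) := fun i => by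
    simp only [w, c, map_mul, map_div₀, hσF, hσq₀, hσS]
  have hτw : ∀ i, ρ (.sr 0) (w i) = w (-i) := fun i => by
    simp only [w, c, map_mul, map_div₀, hτF, hτq₀, hτS]
  have hwinj : Function.Injective w := fun i j hij => hF.injective (mul_right_cancel₀ hc0 hij)
  have hne : cyclicCubic w ≠ cyclicCubicRev w := by
    simp only [w, cyclicCubic_mul, cyclicCubicRev_mul]
    exact fun h0 => hF.cyclicCubic_ne hn (mul_right_cancel₀ (pow_ne_zero 3 hc0) h0)
  let q : L := cyclicCubic w * a + cyclicCubicRev w * a'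
  have hσq : ρ (.r 1) q = q := by
    simp only [q, map_add, map_mul, hσa, hσa']
    rw [show ρ (.r 1) (cyclicCubic w) = _ from map_cyclicCubic_of_shift (ρ (.r 1) : L →+* L) hσw,
      show ρ (.r 1) (cyclicCubicRev w) = _ from
        map_cyclicCubicRev_of_shift (ρ (.r 1) : L →+* L) hσw]
  have hτq : ρ (.sr 0) q = q := by
    simp only [q, map_add, map_mul, hτa, hτa']
    rw [show ρ (.sr 0) (cyclicCubic w) = _ from map_cyclicCubic_of_neg (ρ (.sr 0) : L →+* L) hτw,
      show ρ (.sr 0) (cyclicCubicRev w) = _ from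
        map_cyclicCubicRev_of_neg (ρ (.sr 0) : L →+* L) hτw, add_comm]
  let t : Fin n → L := fun j => ∑ i, w i ^ (j : ℕ) * C i
  have hwtq : IntermediateField.adjoin k
      (Set.range fun o : Option (ZMod n ⊕ Fin n) => o.elim q (Sum.elim w t)) = ⊤ := by
    set E := IntermediateField.adjoin k
      (Set.range fun o : Option (ZMod n ⊕ Fin n) => o.elim q (Sum.elim w t))
    have hqE : q ∈ E := IntermediateField.subset_adjoin k _ ⟨none, rfl⟩
    have hwE : ∀ i, w i ∈ E :=
      fun i => IntermediateField.subset_adjoin k _ ⟨some (Sum.inl i), rfl⟩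
    have htE : ∀ j, t j ∈ E :=
      fun j => IntermediateField.subset_adjoin k _ ⟨some (Sum.inr j), rfl⟩
    have hq₀E : q₀ ∈ E := by
      have : q₀ = ∑ i, w i := by
        rw [← Finset.sum_mul]
        exact (mul_div_cancel₀ q₀ hS0).symm
      rw [this]
      exact sum_mem fun i _ => hwE i
    obtain ⟨haE, ha'E⟩ := E.mem_and_mem_of_add_mem (cyclicCubic_mem E hwE)
      (cyclicCubicRev_mem E hwE) hne hq₀E hqE
    have hSE : S ∈ E := by
      have hu : ∏ i, w i / q₀ = (∏ i, F i) / S ^ n := by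
        have : ∀ i, w i / q₀ = F i / S := fun i => by
          simp only [w, c]
          field_simp
        simp only [this, Finset.prod_div_distrib, Finset.prod_const, Finset.card_univ, ZMod.card]
      have : S = (∏ i, w i / q₀) / (a * a') := by
        rw [hu]
        simp only [a, a', A', hm]
        field_simp
        ring
      rw [this]
      exact div_mem (prod_mem fun i _ => div_mem (hwE i) hq₀E) (mul_mem haE ha'E)
    refine htop E ?_ ?_ ?_
    · have : A = a * S ^ (m + 1) := by simp only [a]; field_simp
      rw [this]
      exact mul_mem haE (pow_mem hSE _)
    · intro i
      have : F i = w i / (q₀ / S) := (mul_div_cancel_right₀ _ hc0).symm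
      rw [this]
      exact div_mem (hwE i) (div_mem hq₀E hSE)
    · exact E.mem_of_sum_pow_mul_mem hwinj hwE fun j hj => htE ⟨j, by rwa [ZMod.card] at hj⟩
  refine ⟨w, t, q, hσw, hτw,
    fun j => map_sum_pow_mul_of_perm (Equiv.addRight 1) (ρ (.r 1) : L →+* L) hσw hσC j,
    fun j => map_sum_pow_mul_of_perm (Equiv.neg _) (ρ (.sr 0) : L →+* L) hτw hτC j,
    hσq, hτq, hind.of_adjoin_eq_top hwtq ?_, hwtq⟩
  simp [ZMod.card]

/-- let `n ≥ 3` be odd and `k` any field.  Let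
`L = k(A, B_0, …, B_{n-1}, C_0, …, C_{n-1})` be a rational function field in
`2n+1` variables over `k` and let `D_n` act on `L` by `k`-algebra automorphisms
(trivially on `k`) by
`σ : A ↦ A, B_i ↦ B_{i+1}, C_i ↦ C_{i+1}` and
`τ : A ↦ A⁻¹B_0⋯B_{n-1}, B_i ↦ B_{1-i}C_{-i}C_{1-i}⁻¹, C_i ↦ C_{-i}`
(indices mod `n`; the multiplicative action on `k(R^{ab})`).  Let `k(D_n)` be
Noether's invariant field: the fixed field of the `D_n`-action on the rational
function field `k(x_g : g ∈ D_n)` given by `h • x_g = x_{hg}`.  Then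
`L^{D_n}` is `k`-algebra isomorphic to the rational function field in one
variable over `k(D_n)`. -/
theorem fixedField_relationModule_eq_noether_field (n : ℕ) (hn : 3 ≤ n)
    (hodd : Odd n) [NeZero n]
    (k : Type) [Field k]
    -- the function field L = k(A, B_i, C_i) with the multiplicative D_n-action
    (L : Type) [Field L] [Algebra k L]
    (A : L) (B C : ZMod n → L)
    (hind : AlgebraicIndependent k (Sum.elim (fun _ : Unit => A) (Sum.elim B C)))
    (hgen : IntermediateField.adjoin k
      (Set.range (Sum.elim (fun _ : Unit => A) (Sum.elim B C))) = ⊤)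
    (ρ : DihedralGroup n →* (L ≃ₐ[k] L))
    (hσA : ρ (DihedralGroup.r 1) A = A)
    (hσB : ∀ i : ZMod n, ρ (DihedralGroup.r 1) (B i) = B (i + 1))
    (hσC : ∀ i : ZMod n, ρ (DihedralGroup.r 1) (C i) = C (i + 1))
    (hτA : ρ (DihedralGroup.sr 0) A = A⁻¹ * ∏ i : ZMod n, B i)
    (hτB : ∀ i : ZMod n,
      ρ (DihedralGroup.sr 0) (B i) = B (1 - i) * C (-i) * (C (1 - i))⁻¹)
    (hτC : ∀ i : ZMod n, ρ (DihedralGroup.sr 0) (C i) = C (-i))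
    -- Noether's setting: k(x_g : g ∈ D_n) with the regular permutation action
    (L' : Type) [Field L'] [Algebra k L']
    (x : DihedralGroup n → L')
    (hind' : AlgebraicIndependent k x)
    (hgen' : IntermediateField.adjoin k (Set.range x) = ⊤)
    (ρ' : DihedralGroup n →* (L' ≃ₐ[k] L'))
    (hρ' : ∀ h g : DihedralGroup n, ρ' h (x g) = x (h * g)) :
    Nonempty (↥(IntermediateField.fixedField ρ.range) ≃ₐ[k]
      FractionRing (Polynomial ↥(IntermediateField.fixedField ρ'.range))) := by
  obtain ⟨w, t, q, hσw, hτw, hσt, hτt, hσq, hτq, hi, hg⟩ :=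
    exists_generators_relationModule hn hodd hind hgen ρ hσA hσB hσC hτA hτB hτC
  obtain ⟨w', t', hσw', hτw', hσt', hτt', hi', hg'⟩ :=
    exists_generators_regular hn hind' hgen' ρ' hρ'
  exact nonempty_fixedField_algEquiv_of_generators ρ ρ' hσw hτw hσt hτt hσq hτq hσw' hτw' hσt' hτt'
    hi hg hi' hg'
end

section
/- Let k be any field. Let D_2 = ⟨σ, τ : σ^2 = τ^2 = 1, στ = τσ⟩ act on the rational function field k(A, B_0, B_1, C_0, C_1) in 5 variables by k-algebra automorphisms (acting trivially on k): σ(A) = A, σ(B_0) = B_1, σ(B_1) = B_0, σ(C_0) = C_1, σ(C_1) = C_0; τ(A) = A^{-1}B_0B_1, τ(B_0) = B_1C_0C_1^{-1}, τ(B_1) = B_0C_1C_0^{-1}, τ(C_0) = C_0, τ(C_1) = C_1. Then the fixed field k(A, B_0, B_1, C_0, C_1)^{D_2} is rational over k, i.e., isomorphic as a k-algebra to the rational function field k(t_1, t_2, t_3, t_4, t_5). -/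
open IntermediateField in
/-- Adjoining a root of a monic quadratic polynomial over `K` gives elements `a + b x`. -/
theorem exists_eq_add_mul_of_mem_adjoin_simple {K L : Type*} [Field K] [Field L] [Algebra K L]
    {x : L} {s n : K} (hx : x ^ 2 = algebraMap K L s * x - algebraMap K L n)
    {y : L} (hy : y ∈ K⟮x⟯) :
    ∃ a b : K, y = algebraMap K L a + algebraMap K L b * x := by
  have hint : IsIntegral K x := by
    refine ⟨Polynomial.X ^ 2 - Polynomial.C s * Polynomial.X + Polynomial.C n, ?_, ?_⟩
    · monicity!
    · simp [hx]
  rw [← mem_toSubalgebra, adjoin_simple_toSubalgebra_of_isAlgebraic hint.isAlgebraic] at hy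
  induction hy using Algebra.adjoin_induction with
  | mem y hy =>
    obtain rfl : y = x := hy
    exact ⟨0, 1, by simp⟩
  | algebraMap r => exact ⟨r, 0, by simp⟩
  | add y z _ _ hy hz =>
    obtain ⟨a, b, rfl⟩ := hy
    obtain ⟨c, d, rfl⟩ := hz
    exact ⟨a + c, b + d, by simp only [map_add]; ring⟩
  | mul y z _ _ hy hz =>
    obtain ⟨a, b, rfl⟩ := hy
    obtain ⟨c, d, rfl⟩ := hz
    refine ⟨a * c - b * d * n, a * d + b * c + b * d * s, ?_⟩
    simp only [map_add, map_mul, map_sub]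
    linear_combination algebraMap K L b * algebraMap K L d * hx

open IntermediateField in
/-- Relative version of `exists_eq_add_mul_of_mem_adjoin_simple` for intermediate fields. -/
theorem exists_eq_add_mul_of_mem_sup_adjoin_simple {k L : Type*} [Field k] [Field L] [Algebra k L]
    {K : IntermediateField k L} {x s n : L} (hs : s ∈ K) (hn : n ∈ K) (hx : x ^ 2 = s * x - n)
    {y : L} (hy : y ∈ K ⊔ k⟮x⟯) :
    ∃ a ∈ K, ∃ b ∈ K, y = a + b * x := by
  have hle : K ⊔ k⟮x⟯ ≤ K⟮x⟯.restrictScalars k := by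
    refine sup_le (fun z hz ↦ ?_) ?_
    · exact K⟮x⟯.algebraMap_mem ⟨z, hz⟩
    · rw [adjoin_simple_le_iff]
      exact mem_adjoin_simple_self K x
  obtain ⟨a, b, h⟩ := exists_eq_add_mul_of_mem_adjoin_simple (K := K) (s := ⟨s, hs⟩)
    (n := ⟨n, hn⟩) hx (hle hy)
  exact ⟨a, a.2, b, b.2, h⟩

/-- An algebraically independent family does not satisfy a polynomial relation that fails at some
point of the base ring. -/
theorem AlgebraicIndependent.aeval_ne_zero_of_eval_ne_zero {ι R S : Type*} [CommRing R]
    [CommRing S] [Algebra R S] {x : ι → S} (hx : AlgebraicIndependent R x) (P : MvPolynomial ι R)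
    (v : ι → R) (hv : MvPolynomial.eval v P ≠ 0) : MvPolynomial.aeval x P ≠ 0 := by
  intro h
  rw [hx.eq_zero_of_aeval_eq_zero P h] at hv
  simp at hv

open IntermediateField IntermediateField.algebraAdjoinAdjoin in
/-- A finite family over which `L` is algebraic is algebraically independent as soon as it is no
longer than an algebraically independent family indexed by the same type. -/
theorem AlgebraicIndependent.of_isAlgebraic_adjoin {k L ι : Type} [Field k] [Field L] [Algebra k L]
    [Finite ι] {x y : ι → L} (hx : AlgebraicIndependent k x)
    (hy : Algebra.IsAlgebraic (adjoin k (Set.range y)) L) : AlgebraicIndependent k y := by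
  have : Algebra.IsAlgebraic (Algebra.adjoin k (Set.range y)) L :=
    (IsFractionRing.comap_isAlgebraic_iff (A := Algebra.adjoin k (Set.range y))
      (K := adjoin k (Set.range y))).mpr hy
  exact (Algebra.IsAlgebraic.isTranscendenceBasis_of_le_trdeg_of_finite k y
    hx.cardinalMk_le_trdeg).1

/-- let `k` be any field and let `D_2 = ⟨σ, τ⟩` (the Klein four
group) act on the rational function field `L = k(A, B_0, B_1, C_0, C_1)` in `5`
variables by `k`-algebra automorphisms (trivially on `k`):
`σ : A ↦ A, B_0 ↔ B_1, C_0 ↔ C_1` and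
`τ : A ↦ A⁻¹B_0B_1, B_0 ↦ B_1C_0C_1⁻¹, B_1 ↦ B_0C_1C_0⁻¹, C_0 ↦ C_0, C_1 ↦ C_1`
(the multiplicative action on `k(R^{ab})` for `n = 2`).  Then the fixed field
`L^{D_2}` is rational over `k`: it is `k`-algebra isomorphic to the rational
function field in `5` variables over `k`. -/
theorem fixedField_relationModule_D2_rational
    (k : Type) [Field k]
    (L : Type) [Field L] [Algebra k L]
    (A B₀ B₁ C₀ C₁ : L)
    (hind : AlgebraicIndependent k ![A, B₀, B₁, C₀, C₁])
    (hgen : IntermediateField.adjoin k {A, B₀, B₁, C₀, C₁} = ⊤)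
    (ρ : DihedralGroup 2 →* (L ≃ₐ[k] L))
    (hσA : ρ (DihedralGroup.r 1) A = A)
    (hσB0 : ρ (DihedralGroup.r 1) B₀ = B₁)
    (hσB1 : ρ (DihedralGroup.r 1) B₁ = B₀)
    (hσC0 : ρ (DihedralGroup.r 1) C₀ = C₁)
    (hσC1 : ρ (DihedralGroup.r 1) C₁ = C₀)
    (hτA : ρ (DihedralGroup.sr 0) A = A⁻¹ * B₀ * B₁)
    (hτB0 : ρ (DihedralGroup.sr 0) B₀ = B₁ * C₀ * C₁⁻¹)
    (hτB1 : ρ (DihedralGroup.sr 0) B₁ = B₀ * C₁ * C₀⁻¹)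
    (hτC0 : ρ (DihedralGroup.sr 0) C₀ = C₀)
    (hτC1 : ρ (DihedralGroup.sr 0) C₁ = C₁) :
    Nonempty (↥(IntermediateField.fixedField ρ.range) ≃ₐ[k]
      FractionRing (MvPolynomial (Fin 5) k)) := by
  have hne (P : MvPolynomial (Fin 5) k) := hind.aeval_ne_zero_of_eval_ne_zero P
  have hA : A ≠ 0 := hind.ne_zero 0
  have hB0 : B₀ ≠ 0 := hind.ne_zero 1
  have hB1 : B₁ ≠ 0 := hind.ne_zero 2
  have hC0 : C₀ ≠ 0 := hind.ne_zero 3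
  have hC1 : C₁ ≠ 0 := hind.ne_zero 4
  have hS : C₀ + C₁ ≠ 0 := by
    simpa using hne (.X 3 + .X 4) ![0, 0, 0, 1, 0] (by simp)
  have hC : C₀ - C₁ ≠ 0 := by
    simpa using hne (.X 3 - .X 4) ![0, 0, 0, 1, 0] (by simp)
  have hX : B₀ * C₁ + B₁ * C₀ ≠ 0 := by
    simpa using hne (.X 1 * .X 4 + .X 2 * .X 3) ![0, 1, 0, 0, 1] (by simp)
  have hU : B₀ * C₁ - B₁ * C₀ ≠ 0 := by
    simpa using hne (.X 1 * .X 4 - .X 2 * .X 3) ![0, 1, 0, 0, 1] (by simp)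
  have hD : (A ^ 2 - B₀ * B₁) ^ 2 * C₀ * C₁ - A ^ 2 * (B₀ * C₁ - B₁ * C₀) ^ 2 ≠ 0 := by
    have h := hne ((.X 0 ^ 2 - .X 1 * .X 2) ^ 2 * .X 3 * .X 4
      - .X 0 ^ 2 * (.X 1 * .X 4 - .X 2 * .X 3) ^ 2) ![1, 1, 1, 0, 1] (by simp)
    simp only [map_sub, map_mul, map_pow, MvPolynomial.aeval_X] at h
    exact h
  obtain ⟨S, hSdef⟩ : ∃ S, S = C₀ + C₁ := ⟨_, rfl⟩
  obtain ⟨X, hXdef⟩ : ∃ X, X = B₀ / C₀ + B₁ / C₁ := ⟨_, rfl⟩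
  obtain ⟨z, hzdef⟩ : ∃ z, z = (B₀ + B₁) / (X * S) := ⟨_, rfl⟩
  obtain ⟨n, hndef⟩ : ∃ n, n = C₀ * C₁ / S ^ 2 := ⟨_, rfl⟩
  obtain ⟨q, hqdef⟩ : ∃ q, q = (A - A⁻¹ * B₀ * B₁) / ((C₀ - C₁) * (B₀ / C₀ - B₁ / C₁)) :=
    ⟨_, rfl⟩
  obtain ⟨p, hpdef⟩ : ∃ p, p = A / (X * S) - q * z := ⟨_, rfl⟩
  have hS0 : S ≠ 0 := hSdef ▸ hS
  have hX0 : X ≠ 0 := by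
    rw [hXdef, div_add_div _ _ hC0 hC1]
    exact div_ne_zero (by rwa [mul_comm C₀]) (mul_ne_zero hC0 hC1)
  have hU0 : B₀ / C₀ - B₁ / C₁ ≠ 0 := by
    rw [div_sub_div _ _ hC0 hC1]
    exact div_ne_zero (by rwa [mul_comm C₀]) (mul_ne_zero hC0 hC1)
  have hz1 : 2 * z - 1 = (C₀ - C₁) * (B₀ / C₀ - B₁ / C₁) / (X * S) := by
    rw [hzdef, eq_div_iff (mul_ne_zero hX0 hS0), sub_mul, mul_assoc,
      div_mul_cancel₀ _ (mul_ne_zero hX0 hS0), hXdef, hSdef]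
    field_simp
    ring
  have hz10 : 2 * z - 1 ≠ 0 :=
    hz1 ▸ div_ne_zero (mul_ne_zero hC hU0) (mul_ne_zero hX0 hS0)
  have hq1 : q * (2 * z - 1) = (A - A⁻¹ * B₀ * B₁) / (X * S) := by
    rw [hz1, hqdef]
    field_simp
  have hp1 : A⁻¹ * B₀ * B₁ / (X * S) = p + q * (1 - z) := by
    rw [hpdef]
    linear_combination hq1 + sub_div A (A⁻¹ * B₀ * B₁) (X * S)
  have hp0 : A / (X * S) = p + q * z := by rw [hpdef]; ring
  have hAA : (p + q * z) * (p + q * (1 - z)) = B₀ * B₁ / (X * S) ^ 2 := by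
    rw [← hp0, ← hp1]
    field_simp
  have hn4 : 1 - 4 * n = (C₀ - C₁) ^ 2 / S ^ 2 := by
    rw [hndef, hSdef]
    field_simp
    ring
  have hnorm : (1 - 4 * n) * (B₀ * B₁ / (X * S) ^ 2) = n * (z * (1 - z) - n) := by
    have h : (C₀ - C₁) ^ 2 * (B₀ * B₁) =
        C₀ * C₁ * ((B₀ + B₁) * (X * S - (B₀ + B₁)) - C₀ * C₁ * X ^ 2) := by
      rw [hXdef, hSdef]
      field_simp
      ring
    rw [hn4, hndef, hzdef]
    field_simp
    linear_combination h
  have hDz : q ^ 2 * (1 - 4 * n) - n ≠ 0 := by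
    have : q ^ 2 * (1 - 4 * n) - n =
        ((A ^ 2 - B₀ * B₁) ^ 2 * C₀ * C₁ - A ^ 2 * (B₀ * C₁ - B₁ * C₀) ^ 2) * (C₀ * C₁) /
          (A ^ 2 * (B₀ * C₁ - B₁ * C₀) ^ 2 * S ^ 2) := by
      rw [hn4, hndef, hqdef, div_sub_div _ _ hC0 hC1]
      rw [mul_comm C₀ B₁]
      field_simp
    rw [this]
    exact div_ne_zero (mul_ne_zero hD (mul_ne_zero hC0 hC1))
      (mul_ne_zero (mul_ne_zero (pow_ne_zero 2 hA) (pow_ne_zero 2 hU)) (pow_ne_zero 2 hS0))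
  have hw : z * (1 - z) =
      (-n ^ 2 - (p ^ 2 + p * q) * (1 - 4 * n)) / (q ^ 2 * (1 - 4 * n) - n) := by
    rw [eq_div_iff hDz]
    linear_combination hnorm + (1 - 4 * n) * hAA
  let t : Fin 5 → L := ![X, S, n, p, q]
  let K : IntermediateField k L := IntermediateField.adjoin k (Set.range t)
  have ht (i : Fin 5) : t i ∈ K := IntermediateField.subset_adjoin _ _ ⟨i, rfl⟩
  have hXK : X ∈ K := ht 0
  have hSK : S ∈ K := ht 1
  have hnK : n ∈ K := ht 2
  have hpK : p ∈ K := ht 3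
  have hqK : q ∈ K := ht 4
  have h4K : 1 - 4 * n ∈ K := sub_mem K.one_mem (mul_mem (ofNat_mem K 4) hnK)
  have hwK : z * (1 - z) ∈ K := by
    rw [hw]
    exact div_mem (sub_mem (neg_mem (pow_mem hnK 2)) (mul_mem (add_mem (pow_mem hpK 2)
      (mul_mem hpK hqK)) h4K)) (sub_mem (mul_mem (pow_mem hqK 2) h4K) hnK)
  have hNK : C₀ * C₁ ∈ K := by
    have : C₀ * C₁ = n * S ^ 2 := by rw [hndef]; field_simp
    rw [this]
    exact mul_mem hnK (pow_mem hSK 2)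
  let M : IntermediateField k L := (K ⊔ IntermediateField.adjoin k {z}) ⊔ IntermediateField.adjoin k {C₀}
  have hKM1 : K ≤ K ⊔ IntermediateField.adjoin k {z} := le_sup_left
  have hKM : K ≤ M := hKM1.trans le_sup_left
  have hM : M = ⊤ := by
    have hzM : z ∈ M :=
      (le_sup_right.trans le_sup_left : IntermediateField.adjoin k {z} ≤ M) (IntermediateField.mem_adjoin_simple_self k z)
    have hC0M : C₀ ∈ M :=
      (le_sup_right : IntermediateField.adjoin k {C₀} ≤ M) (IntermediateField.mem_adjoin_simple_self k C₀)
    have hC1M : C₁ ∈ M := by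
      have : C₁ = S - C₀ := by rw [hSdef]; ring
      exact this ▸ sub_mem (hKM hSK) hC0M
    have hYM : B₀ + B₁ ∈ M := by
      have : B₀ + B₁ = z * (X * S) := by rw [hzdef]; field_simp
      exact this ▸ mul_mem hzM (mul_mem (hKM hXK) (hKM hSK))
    have hB0M : B₀ ∈ M := by
      have : B₀ = C₀ * ((B₀ + B₁ - C₁ * X) / (C₀ - C₁)) := by
        rw [hXdef]
        field_simp
        ring
      rw [this]
      exact mul_mem hC0M (div_mem (sub_mem hYM (mul_mem hC1M (hKM hXK))) (sub_mem hC0M hC1M))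
    have hB1M : B₁ ∈ M := by
      simpa using sub_mem hYM hB0M
    have hAM : A ∈ M := by
      have : A = (p + q * z) * (X * S) := by rw [← hp0]; field_simp
      rw [this]
      exact mul_mem (add_mem (hKM hpK) (mul_mem (hKM hqK) hzM)) (mul_mem (hKM hXK) (hKM hSK))
    rw [eq_top_iff, ← hgen, IntermediateField.adjoin_le_iff]
    rintro y (rfl | rfl | rfl | rfl | rfl) <;> assumption
  have hz2 : z ^ 2 = 1 * z - z * (1 - z) := by ring
  have hC2 : C₀ ^ 2 = S * C₀ - C₀ * C₁ := by rw [hSdef]; ring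
  have hspan (y : L) : ∃ a ∈ K, ∃ b ∈ K, ∃ c ∈ K, ∃ d ∈ K,
      y = (a + b * z) + (c + d * z) * C₀ := by
    have hy : y ∈ M := hM ▸ IntermediateField.mem_top
    obtain ⟨x₀, hx₀, x₁, hx₁, rfl⟩ :=
      exists_eq_add_mul_of_mem_sup_adjoin_simple (hKM1 hSK) (hKM1 hNK) hC2 hy
    obtain ⟨a, ha, b, hb, rfl⟩ :=
      exists_eq_add_mul_of_mem_sup_adjoin_simple K.one_mem hwK hz2 hx₀
    obtain ⟨c, hc, d, hd, rfl⟩ :=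
      exists_eq_add_mul_of_mem_sup_adjoin_simple K.one_mem hwK hz2 hx₁
    exact ⟨a, ha, b, hb, c, hc, d, hd, rfl⟩
  have hint {x s m : L} (hs : s ∈ K) (hm : m ∈ K) (hx : x ^ 2 = s * x - m) : IsIntegral K x := by
    refine ⟨Polynomial.X ^ 2 - Polynomial.C ⟨s, hs⟩ * Polynomial.X + Polynomial.C ⟨m, hm⟩,
      by monicity!, ?_⟩
    simp [hx]
  have halg : Algebra.IsAlgebraic K L := by
    refine ⟨fun y ↦ ?_⟩
    obtain ⟨a, ha, b, hb, c, hc, d, hd, rfl⟩ := hspan y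
    have hK {x : L} (hx : x ∈ K) : IsIntegral K x :=
      isIntegral_algebraMap (R := K) (A := L) (x := ⟨x, hx⟩)
    have hzi := hint K.one_mem hwK hz2
    have hCi := hint hSK hNK hC2
    exact (((hK ha).add ((hK hb).mul hzi)).add
      (((hK hc).add ((hK hd).mul hzi)).mul hCi)).isAlgebraic
  have htind : AlgebraicIndependent k t := hind.of_isAlgebraic_adjoin halg
  generalize hσ : ρ (DihedralGroup.r 1) = σ at *
  generalize hτ : ρ (DihedralGroup.sr 0) = τ at *
  have hσX : σ X = X := by simp [hXdef, hσB0, hσB1, hσC0, hσC1, add_comm]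
  have hσS : σ S = S := by simp [hSdef, hσC0, hσC1, add_comm]
  have hσz : σ z = z := by simp [hzdef, hσB0, hσB1, hσX, hσS, add_comm]
  have hσn : σ n = n := by simp [hndef, hσC0, hσC1, hσS, mul_comm]
  have hσq : σ q = q := by
    simp only [hqdef, map_div₀, map_sub, map_mul, map_inv₀, hσA, hσB0, hσB1, hσC0, hσC1]
    ring
  have hσp : σ p = p := by simp [hpdef, hσA, hσX, hσS, hσz, hσq]
  have hτX : τ X = X := by
    simp only [hXdef, map_div₀, map_add, hτB0, hτB1, hτC0, hτC1]
    field_simp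
    ring
  have hτS : τ S = S := by simp [hSdef, hτC0, hτC1]
  have hτz : τ z = 1 - z := by
    rw [eq_sub_iff_add_eq]
    simp only [hzdef, map_div₀, map_add, map_mul, hτX, hτS, hτB0, hτB1]
    rw [← add_div, div_eq_one_iff_eq (mul_ne_zero hX0 hS0), hXdef, hSdef]
    field_simp
    ring
  have hτn : τ n = n := by simp [hndef, hτC0, hτC1, hτS]
  have hτp : τ p + τ q * (1 - z) = p + q * (1 - z) := by
    have := congrArg τ hp0
    simpa only [map_div₀, map_mul, map_add, hτA, hτX, hτS, hτz, hp1, eq_comm] using this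
  have hτA' : τ (A⁻¹ * B₀ * B₁) = A := by
    simp only [map_mul, map_inv₀, hτA, hτB0, hτB1]
    field_simp
  have hτq : τ q = q := by
    have h := congrArg τ hq1
    simp only [map_div₀, map_mul, map_sub, hτA, map_one, map_ofNat, hτz, hτX, hτS] at h
    simp only [← map_mul, hτA'] at h
    refine mul_right_cancel₀ hz10 ?_
    linear_combination -h - hq1 + sub_div A (A⁻¹ * B₀ * B₁) (X * S) +
      sub_div (A⁻¹ * B₀ * B₁) A (X * S)
  have hτp : τ p = p := by simpa [hτq] using hτp
  have hfix (g : L ≃ₐ[k] L) (hX : g X = X) (hS : g S = S) (hn : g n = n) (hp : g p = p)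
      (hq : g q = q) {x : L} (hx : x ∈ K) : g x = x := by
    induction hx using IntermediateField.adjoin_induction with
    | mem x hx =>
      obtain ⟨i, rfl⟩ := hx
      fin_cases i <;> assumption
    | algebraMap x => exact g.commutes x
    | add x y _ _ hx hy => rw [map_add, hx, hy]
    | inv x _ hx => rw [map_inv₀, hx]
    | mul x y _ _ hx hy => rw [map_mul, hx, hy]
  have hσK {x : L} (hx : x ∈ K) : σ x = x := hfix σ hσX hσS hσn hσp hσq hx
  have hτK {x : L} (hx : x ∈ K) : τ x = x := hfix τ hτX hτS hτn hτp hτq hx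
  have hfixed : IntermediateField.fixedField ρ.range = K := by
    refine le_antisymm (fun y hy ↦ ?_) ?_
    · rw [IntermediateField.mem_fixedField_iff] at hy
      have hσy : σ y = y := hy σ ⟨_, hσ⟩
      have hτy : τ y = y := hy τ ⟨_, hτ⟩
      obtain ⟨a, ha, b, hb, c, hc, d, hd, rfl⟩ := hspan y
      simp only [map_add, map_mul, hσK ha, hσK hb, hσK hc, hσK hd, hσz, hσC0] at hσy
      simp only [map_add, map_mul, hτK ha, hτK hb, hτK hc, hτK hd, hτz, hτC0] at hτy
      have hcd : c + d * z = 0 := by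
        refine (mul_eq_zero.mp ?_).resolve_right hC
        linear_combination -hσy
      have hb0 : b = 0 := by
        have hd0 : (b + d * C₀) * (2 * z - 1) = 0 := by linear_combination -hτy
        have hd1 := (mul_eq_zero.mp hd0).resolve_right hz10
        have hd2 := congrArg σ hd1
        simp only [map_add, map_mul, hσK hb, hσK hd, hσC0, map_zero] at hd2
        have hd3 : d = 0 := by
          refine (mul_eq_zero.mp ?_).resolve_right hC
          linear_combination hd1 - hd2
        simpa [hd3] using hd1
      simpa [hcd, hb0] using ha
    · intro y hy
      rw [IntermediateField.mem_fixedField_iff]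
      rintro _ ⟨g, rfl⟩
      have hr (i : ZMod 2) : ρ (DihedralGroup.r i) y = y := by
        fin_cases i
        · change ρ 1 y = y
          simp
        · exact (congrArg (· y) hσ).trans (hσK hy)
      cases g with
      | r i => exact hr i
      | sr i =>
        rw [← zero_add i, ← DihedralGroup.sr_mul_r, map_mul, AlgEquiv.mul_apply, hr, hτ, hτK hy]
  exact hfixed ▸ ⟨htind.aevalEquivField.symm⟩
end
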